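/- arXiv:math/0508508 — 5 statements merged into one kernel-verified Lean document; each statement's English description precedes it below -/
import Mathlib

section
/- Any totally ordered (under inclusion) family of finite unions of linear subspaces of a finite dimensional vector space is well ordered under inclusion: every nonempty subfamily has a minimal element. -/
open Module

/-- In a nonempty chain of finite unions of submodules of an Artinian module, some member has the
smallest trace on any given submodule. -/
theorem exists_inter_submodule_subset_of_isChain {R M : Type*} [Ring R] [AddCommGroup M]
    [Module R M] [IsArtinian R M] {𝒯 : Set (Set M)}
    (hfin : ∀ W ∈ 𝒯, ∃ 𝒳 : Finset (Submodule R M), W = ⋃ V ∈ 𝒳, (V : Set M))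
    (htot : ∀ W ∈ 𝒯, ∀ W' ∈ 𝒯, W ⊆ W' ∨ W' ⊆ W) (hne : 𝒯.Nonempty) (V : Submodule R M) :
    ∃ m ∈ 𝒯, ∀ W ∈ 𝒯, m ∩ V ⊆ W := by
  induction V using WellFoundedLT.induction with
  | ind V ih =>
  by_cases hV : ∀ W ∈ 𝒯, (V : Set M) ⊆ W
  · obtain ⟨m, hm⟩ := hne
    exact ⟨m, hm, fun W hW => Set.inter_subset_right.trans (hV W hW)⟩
  push Not at hV
  obtain ⟨W₀, hW₀, hVW₀⟩ := hV
  obtain ⟨𝒳, rfl⟩ := hfin W₀ hW₀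
  have hlt : ∀ X ∈ 𝒳, X ⊓ V < V := fun X hX => inf_lt_right.2 fun hVX =>
    hVW₀ fun _ hx => Set.mem_biUnion hX (hVX hx)
  have key : ∀ 𝒴 ⊆ 𝒳, ∃ m ∈ 𝒯, (m ⊆ ⋃ X ∈ 𝒳, (X : Set M)) ∧
      ∀ X ∈ 𝒴, ∀ W ∈ 𝒯, m ∩ (X ⊓ V : Submodule R M) ⊆ W := by
    classical
    intro 𝒴
    induction 𝒴 using Finset.induction_on with
    | empty => exact fun _ => ⟨_, hW₀, subset_rfl, by simp⟩
    | insert Y 𝒴 _ ih' =>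
      intro h𝒴
      obtain ⟨hY, h𝒴⟩ := Finset.insert_subset_iff.1 h𝒴
      obtain ⟨m, hm, hmW₀, hmin⟩ := ih' h𝒴
      obtain ⟨n, hn, hnmin⟩ := ih _ (hlt Y hY)
      rcases htot m hm n hn with h | h
      · refine ⟨m, hm, hmW₀, (Finset.forall_mem_insert _ _ _).2 ⟨fun W hW => ?_, hmin⟩⟩
        exact (Set.inter_subset_inter_left _ h).trans (hnmin W hW)
      · refine ⟨n, hn, h.trans hmW₀, (Finset.forall_mem_insert _ _ _).2 ⟨hnmin, ?_⟩⟩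
        exact fun X hX W hW => (Set.inter_subset_inter_left _ h).trans (hmin X hX W hW)
  obtain ⟨m, hm, hmW₀, hmin⟩ := key 𝒳 subset_rfl
  refine ⟨m, hm, fun W hW x hx => ?_⟩
  obtain ⟨X, hX, hxX⟩ := Set.mem_iUnion₂.1 (hmW₀ hx.1)
  exact hmin X hX W hW ⟨hx.1, hxX, hx.2⟩

/-- A totally ordered (under inclusion) family of finite unions of linear subspaces
is well ordered: every nonempty subfamily has a least element. -/
theorem stmt2 {H : Type*} [AddCommGroup H] [Module ℝ H] [FiniteDimensional ℝ H]
    (𝒮 : Set (Set H))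
    (hfin : ∀ W ∈ 𝒮, ∃ 𝒳 : Finset (Submodule ℝ H), W = ⋃ V ∈ 𝒳, (V : Set H))
    (htot : ∀ W ∈ 𝒮, ∀ W' ∈ 𝒮, W ⊆ W' ∨ W' ⊆ W) :
    ∀ 𝒯 ⊆ 𝒮, 𝒯.Nonempty → ∃ m ∈ 𝒯, ∀ W ∈ 𝒯, m ⊆ W := by
  intro 𝒯 h𝒯 hne
  simpa using exists_inter_submodule_subset_of_isChain (fun W hW => hfin W (h𝒯 hW))
    (fun W hW W' hW' => htot W (h𝒯 hW) W' (h𝒯 hW')) hne ⊤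
end

section
/- Let ℬ be a monoid acting symplectically on a symplectic space (H, ω). Assume the induced action of ℬ on the projective space ℙH is minimal and there exists a line λ ∈ ℙH such that the stabilizer ℬ_λ acts minimally on the space of Lagrangian flags ℒ(H^λ) of the symplectic reduction H^λ = H_λ/λ. Then ℬ acts minimally on the space of Lagrangian flags ℒ(H). -/
open Module

/-- The gap distance between two subspaces. -/
noncomputable def subDist {H : Type*} [NormedAddCommGroup H] [NormedSpace ℝ H]
    (F F' : Submodule ℝ H) : ℝ :=
  Metric.hausdorffDist ((F : Set H) ∩ Metric.closedBall 0 1)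
    ((F' : Set H) ∩ Metric.closedBall 0 1)

/-- The metric topology on the set of subspaces of `H`. -/
instance grassTop {H : Type*} [NormedAddCommGroup H] [NormedSpace ℝ H] :
    TopologicalSpace (Submodule ℝ H) :=
  TopologicalSpace.generateFrom
    {U | ∃ (F : Submodule ℝ H) (ε : ℝ), 0 < ε ∧ U = {F' : Submodule ℝ H | subDist F F' < ε}}

/-- A Lagrangian flag for `ω`: nested isotropic subspaces `F_1 ⊂ ⋯ ⊂ F_g` with
`dim F_i = i`. -/
def IsLagFlag {H : Type*} [NormedAddCommGroup H] [NormedSpace ℝ H]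
    (ω : H →ₗ[ℝ] H →ₗ[ℝ] ℝ) (g : ℕ) (F : Fin g → Submodule ℝ H) : Prop :=
  (∀ i : Fin g, finrank ℝ (F i) = (i : ℕ) + 1) ∧
  (∀ i j : Fin g, i ≤ j → F i ≤ F j) ∧
  (∀ i : Fin g, ∀ u ∈ F i, ∀ v ∈ F i, ω u v = 0)

open Topology Filter

/-- The unit ball of a subspace, as a nonempty compact set. -/
noncomputable def unitBallCompacts {H : Type*} [NormedAddCommGroup H] [NormedSpace ℝ H]
    [FiniteDimensional ℝ H] (F : Submodule ℝ H) : TopologicalSpace.NonemptyCompacts H where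
  carrier := (F : Set H) ∩ Metric.closedBall 0 1
  isCompact' := by
    have := FiniteDimensional.proper_real H
    exact (isCompact_closedBall 0 1).inter_left F.closed_of_finiteDimensional
  nonempty' := ⟨0, F.zero_mem, by simp⟩

section Grassmannian

variable {H : Type*} [NormedAddCommGroup H] [NormedSpace ℝ H]

theorem isOpen_setOf_subDist_lt (F : Submodule ℝ H) {ε : ℝ} (hε : 0 < ε) :
    IsOpen {F' | subDist F F' < ε} :=
  .basic _ ⟨F, ε, hε, rfl⟩

theorem subDist_map_le (G : Submodule ℝ H) (A : H →L[ℝ] H) {ε : ℝ}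
    (hε : ε ≤ 1 / 2) (hA : ‖A - 1‖ ≤ ε) : subDist (G.map A.toLinearMap) G ≤ 4 * ε := by
  have hε0 : 0 ≤ ε := (norm_nonneg _).trans hA
  have hAu : ∀ u, ‖A u - u‖ ≤ ε * ‖u‖ := fun u => by
    simpa using (A - 1).le_of_opNorm_le hA u
  refine Metric.hausdorffDist_le_of_mem_dist (by positivity) ?_ ?_
  · rintro _ ⟨⟨u, hu, rfl⟩, hw⟩
    have hw1 : ‖A u‖ ≤ 1 := by simpa using hw
    have h1 := hAu u
    have h2 : ‖u‖ ≤ ‖A u‖ + ‖A u - u‖ := by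
      simpa using norm_sub_le (A u) (A u - u)
    have hu2 : (1 - ε) * ‖u‖ ≤ 1 := by linarith
    refine ⟨(1 - ε) • u, ⟨G.smul_mem _ hu, ?_⟩, ?_⟩
    · rw [mem_closedBall_zero_iff, norm_smul, Real.norm_of_nonneg (by linarith)]
      exact hu2
    · have h3 : A u - (1 - ε) • u = (A u - u) + ε • u := by module
      have h4 : ‖ε • u‖ = ε * ‖u‖ := by rw [norm_smul, Real.norm_of_nonneg hε0]
      have h5 : ‖u‖ ≤ 2 := by nlinarith [norm_nonneg u]
      rw [dist_eq_norm]
      calc ‖A u - (1 - ε) • u‖ ≤ ‖A u - u‖ + ‖ε • u‖ := h3 ▸ norm_add_le _ _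
        _ ≤ 4 * ε := by nlinarith
  · rintro u ⟨hu, hu1⟩
    rw [mem_closedBall_zero_iff] at hu1
    have h1 : ‖A u - u‖ ≤ ε := (hAu u).trans (mul_le_of_le_one_right hε0 hu1)
    have h2 : ‖A u‖ ≤ ‖A u - u‖ + ‖u‖ := by simpa using norm_add_le (A u - u) u
    have hpos : 0 < 1 + ε := by linarith
    refine ⟨(1 + ε)⁻¹ • A u, ⟨Submodule.smul_mem _ _ ⟨u, hu, rfl⟩, ?_⟩, ?_⟩
    · rw [mem_closedBall_zero_iff, norm_smul, norm_inv, Real.norm_of_nonneg hpos.le,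
        inv_mul_le_one₀ hpos]
      linarith
    · have h3 : u - (1 + ε)⁻¹ • A u = (1 + ε)⁻¹ • (ε • u - (A u - u)) := by
        rw [eq_inv_smul_iff₀ hpos.ne', smul_sub, smul_inv_smul₀ hpos.ne']
        module
      have h4 : ‖ε • u‖ ≤ ε := by
        rw [norm_smul, Real.norm_of_nonneg hε0]
        exact mul_le_of_le_one_right hε0 hu1
      have h5 : ‖ε • u - (A u - u)‖ ≤ 2 * ε := (norm_sub_le _ _).trans (by linarith)
      rw [dist_eq_norm, h3, norm_smul, norm_inv, Real.norm_of_nonneg hpos.le,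
        inv_mul_le_iff₀ hpos]
      nlinarith

variable [FiniteDimensional ℝ H]

theorem dist_unitBallCompacts (F F' : Submodule ℝ H) :
    dist (unitBallCompacts F) (unitBallCompacts F') = subDist F F' := rfl

theorem unitBallCompacts_injective :
    Function.Injective (unitBallCompacts : Submodule ℝ H → _) := by
  have key : ∀ F F' : Submodule ℝ H, unitBallCompacts F = unitBallCompacts F' → F ≤ F' := by
    intro F F' h u hu
    by_cases h0 : u = 0
    · simp [h0]
    have hs : (F : Set H) ∩ Metric.closedBall 0 1 = (F' : Set H) ∩ Metric.closedBall 0 1 :=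
      congrArg (fun K : TopologicalSpace.NonemptyCompacts H => (K : Set H)) h
    have hn : ‖u‖ ≠ 0 := norm_ne_zero_iff.2 h0
    have hmem : ‖u‖⁻¹ • u ∈ (F : Set H) ∩ Metric.closedBall 0 1 :=
      ⟨F.smul_mem _ hu, by simp [norm_smul, hn]⟩
    rw [hs] at hmem
    simpa [smul_smul, hn] using F'.smul_mem ‖u‖ hmem.1
  exact fun F F' h => le_antisymm (key F F' h) (key F' F h.symm)

theorem isEmbedding_unitBallCompacts :
    IsEmbedding (unitBallCompacts : Submodule ℝ H → TopologicalSpace.NonemptyCompacts H) := by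
  refine ⟨⟨le_antisymm ?_ ?_⟩, unitBallCompacts_injective⟩
  · rintro _ ⟨V, hV, rfl⟩
    rw [@isOpen_iff_forall_mem_open]
    intro F hF
    obtain ⟨ε, hε, hsub⟩ := Metric.isOpen_iff.1 hV _ hF
    refine ⟨{F' | subDist F F' < ε}, fun F' hF' => hsub ?_, .basic _ ⟨F, ε, hε, rfl⟩, ?_⟩
    · rw [Metric.mem_ball']
      exact hF'
    · rw [Set.mem_ofPred_eq, ← dist_unitBallCompacts, dist_self]
      exact hε
  · refine le_generateFrom ?_
    rintro _ ⟨F, ε, -, rfl⟩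
    refine ⟨Metric.ball (unitBallCompacts F) ε, Metric.isOpen_ball, ?_⟩
    ext F'
    rw [Set.mem_preimage, Metric.mem_ball', dist_unitBallCompacts, Set.mem_ofPred_eq]

instance : T2Space (Submodule ℝ H) := isEmbedding_unitBallCompacts.t2Space

theorem tendsto_of_subDist_tendsto_zero {α : Type*} {l : Filter α} {f : α → Submodule ℝ H}
    {F : Submodule ℝ H} (h : Tendsto (fun a => subDist (f a) F) l (𝓝 0)) :
    Tendsto f l (𝓝 F) := by
  rw [isEmbedding_unitBallCompacts.tendsto_nhds_iff, tendsto_iff_dist_tendsto_zero]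
  exact h

theorem exists_norm_sub_lt_of_subDist_lt {F F' : Submodule ℝ H} {ε : ℝ} (h : subDist F F' < ε)
    {u : H} (hu : u ∈ F) (hu1 : ‖u‖ ≤ 1) : ∃ u' ∈ F', ‖u' - u‖ < ε := by
  obtain ⟨u', hu', hd⟩ := Metric.exists_dist_lt_of_hausdorffDist_lt
    (show u ∈ (F : Set H) ∩ Metric.closedBall 0 1 from ⟨hu, by simpa using hu1⟩) h
    (Metric.hausdorffEDist_ne_top_of_nonempty_of_bounded (unitBallCompacts F).nonempty
      (unitBallCompacts F').nonempty (unitBallCompacts F).isCompact.isBounded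
      (unitBallCompacts F').isCompact.isBounded)
  exact ⟨u', hu'.1, by rwa [← dist_eq_norm, dist_comm]⟩

theorem tendsto_map_of_tendsto_one {α : Type*} {l : Filter α} {A : α → H →L[ℝ] H}
    (hA : Tendsto A l (𝓝 1)) (G : Submodule ℝ H) :
    Tendsto (fun a => G.map (A a).toLinearMap) l (𝓝 G) := by
  have h0 : Tendsto (fun a => ‖A a - 1‖) l (𝓝 0) := tendsto_iff_norm_sub_tendsto_zero.1 hA
  refine tendsto_of_subDist_tendsto_zero (squeeze_zero' (.of_forall fun a =>
    Metric.hausdorffDist_nonneg) ?_ (by simpa using h0.const_mul 4))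
  filter_upwards [h0.eventually (ge_mem_nhds (by norm_num : (0 : ℝ) < 1 / 2))] with a ha
  exact subDist_map_le G (A a) ha le_rfl

end Grassmannian

section OrthonormalFrames

variable {H : Type*} [NormedAddCommGroup H] [InnerProductSpace ℝ H]

theorem subDist_span_range_le {ι : Type*} [Fintype ι] {e e' : ι → H}
    (he : Orthonormal ℝ e) (he' : Orthonormal ℝ e') :
    subDist (Submodule.span ℝ (Set.range e)) (Submodule.span ℝ (Set.range e')) ≤
      ∑ j, ‖e j - e' j‖ := by
  have key : ∀ {e e' : ι → H}, Orthonormal ℝ e → Orthonormal ℝ e' →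
      ∀ u ∈ (Submodule.span ℝ (Set.range e) : Set H) ∩ Metric.closedBall 0 1,
      ∃ u' ∈ (Submodule.span ℝ (Set.range e') : Set H) ∩ Metric.closedBall 0 1,
        dist u u' ≤ ∑ j, ‖e j - e' j‖ := by
    rintro e e' he he' u ⟨hu, hu1⟩
    obtain ⟨c, rfl⟩ := (Submodule.mem_span_range_iff_exists_fun ℝ).1 hu
    rw [mem_closedBall_zero_iff] at hu1
    have hnorm : ‖∑ j, c j • e' j‖ = ‖∑ j, c j • e j‖ := by
      rw [← sq_eq_sq₀ (norm_nonneg _) (norm_nonneg _), ← real_inner_self_eq_norm_sq,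
        ← real_inner_self_eq_norm_sq, he'.inner_sum, he.inner_sum]
    have hc : ∀ j, |c j| ≤ 1 := fun j => by
      have h := abs_real_inner_le_norm (e j) (∑ j, c j • e j)
      rw [he.inner_right_fintype, he.1 j, one_mul] at h
      exact h.trans hu1
    refine ⟨∑ j, c j • e' j, ⟨?_, ?_⟩, ?_⟩
    · exact (Submodule.mem_span_range_iff_exists_fun ℝ).2 ⟨c, rfl⟩
    · rwa [mem_closedBall_zero_iff, hnorm]
    · rw [dist_eq_norm, ← Finset.sum_sub_distrib]
      refine norm_sum_le_of_le _ fun j _ => ?_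
      rw [← smul_sub, norm_smul, Real.norm_eq_abs]
      exact mul_le_of_le_one_left (norm_nonneg _) (hc j)
  refine Metric.hausdorffDist_le_of_mem_dist (Finset.sum_nonneg fun j _ => norm_nonneg _)
    (key he he') fun u hu => ?_
  simpa only [norm_sub_rev] using key he' he u hu

/-- The flag of subspaces spanned by the initial segments of a tuple of vectors. -/
def frameFlag {g : ℕ} (e : Fin g → H) (i : Fin g) : Submodule ℝ H :=
  Submodule.span ℝ (Set.range fun j : {j : Fin g // j ≤ i} => e j)

theorem finrank_frameFlag {g : ℕ} {e : Fin g → H} (he : Orthonormal ℝ e) (i : Fin g) :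
    finrank ℝ (frameFlag e i) = (i : ℕ) + 1 := by
  have hcomp : Orthonormal ℝ fun j : {j : Fin g // j ≤ i} => e j :=
    he.comp _ Subtype.val_injective
  rw [frameFlag, finrank_span_eq_card hcomp.linearIndependent]
  rw [Fintype.card_subtype, Finset.filter_ge_eq_Iic, Fin.card_Iic]

theorem mem_frameFlag {g : ℕ} (e : Fin g → H) {i j : Fin g} (hij : j ≤ i) :
    e j ∈ frameFlag e i :=
  Submodule.subset_span ⟨⟨j, hij⟩, rfl⟩

theorem frameFlag_le_iff {g : ℕ} {e : Fin g → H} {i : Fin g} {K : Submodule ℝ H} :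
    frameFlag e i ≤ K ↔ ∀ j ≤ i, e j ∈ K := by
  simp [frameFlag, Submodule.span_le, Set.range_subset_iff]

theorem isLagFlag_frameFlag {g : ℕ} {ω : H →ₗ[ℝ] H →ₗ[ℝ] ℝ} {e : Fin g → H}
    (he : Orthonormal ℝ e) (hω : ∀ i j, ω (e i) (e j) = 0) : IsLagFlag ω g (frameFlag e) := by
  refine ⟨finrank_frameFlag he, fun i j hij => ?_, fun i u hu v hv => ?_⟩
  · exact frameFlag_le_iff.2 fun k hk => mem_frameFlag e (hk.trans hij)
  · have h1 : ∀ k, frameFlag e i ≤ LinearMap.ker (ω (e k)) := fun k =>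
      frameFlag_le_iff.2 fun j _ => hω k j
    have h2 : frameFlag e i ≤ LinearMap.ker (ω.flip v) :=
      frameFlag_le_iff.2 fun j _ => h1 j hv
    exact h2 hu

theorem IsLagFlag.exists_frame [FiniteDimensional ℝ H] {g : ℕ} {ω : H →ₗ[ℝ] H →ₗ[ℝ] ℝ}
    {F : Fin g → Submodule ℝ H} (hF : IsLagFlag ω g F) :
    ∃ e : Fin g → H, Orthonormal ℝ e ∧ (∀ i j, ω (e i) (e j) = 0) ∧ frameFlag e = F := by
  obtain ⟨hdim, hmono, hiso⟩ := hF
  have hex : ∀ i, ∃ e ∈ F i, ‖e‖ = 1 ∧ ∀ j < i, ∀ u ∈ F j, inner ℝ u e = 0 := by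
    intro i
    obtain ⟨K, hKi, hKdim, hK⟩ :
        ∃ K ≤ F i, finrank ℝ K = (i : ℕ) ∧ ∀ j < i, F j ≤ K := by
      obtain ⟨n, hn⟩ := i
      cases n with
      | zero => exact ⟨⊥, bot_le, by simp, fun j hj => absurd hj (by simp [Fin.lt_def])⟩
      | succ n =>
        refine ⟨F ⟨n, by omega⟩, hmono _ _ (by simp [Fin.le_def]), hdim _, fun j hj => ?_⟩
        exact hmono _ _ (by rw [Fin.lt_def] at hj; rw [Fin.le_def]; simp at hj ⊢; omega)
    have hpos : 0 < finrank ℝ (Kᗮ ⊓ F i : Submodule ℝ H) := by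
      have := Submodule.finrank_add_inf_finrank_orthogonal hKi
      have := hdim i
      omega
    obtain ⟨⟨w, hwK, hwF⟩, hw0⟩ := Module.finrank_pos_iff_exists_ne_zero.1 hpos
    have hw : ‖w‖ ≠ 0 := norm_ne_zero_iff.2 fun h => hw0 (Subtype.ext h)
    refine ⟨‖w‖⁻¹ • w, (F i).smul_mem _ hwF, by simp [norm_smul, hw], fun j hj u hu => ?_⟩
    rw [inner_smul_right, (Submodule.mem_orthogonal K w).1 hwK u (hK j hj hu), mul_zero]
  choose e heF hnorm horth using hex
  have he : Orthonormal ℝ e := by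
    refine ⟨hnorm, fun i j hij => ?_⟩
    rcases lt_or_gt_of_ne hij with h | h
    · exact horth j i h _ (heF i)
    · rw [real_inner_comm]
      exact horth i j h _ (heF j)
  refine ⟨e, he, fun i j => ?_, funext fun i => ?_⟩
  · exact hiso (max i j) _ (hmono _ _ (le_max_left i j) (heF i)) _
      (hmono _ _ (le_max_right i j) (heF j))
  · exact Submodule.eq_of_le_of_finrank_eq
      (frameFlag_le_iff.2 fun j hj => hmono _ _ hj (heF j))
      ((finrank_frameFlag he i).trans (hdim i).symm)

theorem continuousOn_frameFlag [FiniteDimensional ℝ H] {g : ℕ} :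
    ContinuousOn (frameFlag : (Fin g → H) → Fin g → Submodule ℝ H) {e | Orthonormal ℝ e} := by
  intro e he
  refine tendsto_pi_nhds.2 fun i => tendsto_of_subDist_tendsto_zero ?_
  have hlim : Tendsto (fun e' : Fin g → H => ∑ j : {j : Fin g // j ≤ i}, ‖e' j - e j‖)
      (𝓝[{e | Orthonormal ℝ e}] e) (𝓝 0) := by
    have hc : Continuous fun e' : Fin g → H => ∑ j : {j : Fin g // j ≤ i}, ‖e' j - e j‖ := by
      fun_prop
    simpa using (hc.tendsto e).mono_left nhdsWithin_le_nhds
  refine squeeze_zero' (.of_forall fun _ => Metric.hausdorffDist_nonneg) ?_ hlim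
  filter_upwards [self_mem_nhdsWithin] with e' he'
  exact subDist_span_range_le (he'.comp _ Subtype.val_injective)
    (he.comp _ Subtype.val_injective)

theorem isCompact_setOf_isLagFlag [FiniteDimensional ℝ H] (g : ℕ) (ω : H →ₗ[ℝ] H →ₗ[ℝ] ℝ) :
    IsCompact {F : Fin g → Submodule ℝ H | IsLagFlag ω g F} := by
  have := FiniteDimensional.proper_real H
  have himage : {F : Fin g → Submodule ℝ H | IsLagFlag ω g F} =
      frameFlag '' {e | Orthonormal ℝ e ∧ ∀ i j, ω (e i) (e j) = 0} := by
    ext F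
    constructor
    · intro hF
      obtain ⟨e, he, hω, rfl⟩ := IsLagFlag.exists_frame hF
      exact ⟨e, ⟨he, hω⟩, rfl⟩
    · rintro ⟨e, ⟨he, hω⟩, rfl⟩
      exact isLagFlag_frameFlag he hω
  rw [himage]
  refine IsCompact.image_of_continuousOn ?_ (continuousOn_frameFlag.mono fun e he => he.1)
  refine Metric.isCompact_of_isClosed_isBounded ?_ ?_
  · have hωc : ∀ i j : Fin g, Continuous fun e : Fin g → H => ω (e i) (e j) := fun i j => by
      have h : Continuous fun p : H × H => ω p.1 p.2 := by
        simpa [Function.uncurry_def] using (LinearMap.toContinuousBilinearMap ω).continuous₂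
      exact h.comp (by fun_prop : Continuous fun e : Fin g → H => (e i, e j))
    simp only [orthonormal_iff_ite, Set.ofPred_and, Set.ofPred_forall]
    exact (isClosed_iInter fun i => isClosed_iInter fun j =>
      isClosed_eq (by fun_prop) continuous_const).inter
      (isClosed_iInter fun i => isClosed_iInter fun j => isClosed_eq (hωc i j) continuous_const)
  · refine (Metric.isBounded_closedBall (x := (0 : Fin g → H)) (r := 1)).subset fun e he => ?_
    rw [mem_closedBall_zero_iff, pi_norm_le_iff_of_nonneg zero_le_one]
    exact fun i => (he.1.1 i).le

end OrthonormalFrames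

section Transvections

variable {H : Type*} [NormedAddCommGroup H] [NormedSpace ℝ H]

theorem injective_of_symplectic {ω : H →ₗ[ℝ] H →ₗ[ℝ] ℝ}
    (hnd : ∀ u : H, (∀ v : H, ω u v = 0) → u = 0) {A : H →ₗ[ℝ] H}
    (hA : ∀ u v, ω (A u) (A v) = ω u v) : Function.Injective A := by
  refine (injective_iff_map_eq_zero A).2 fun u hu => hnd u fun v => ?_
  rw [← hA, hu, map_zero, LinearMap.zero_apply]

theorem IsLagFlag.map {ω : H →ₗ[ℝ] H →ₗ[ℝ] ℝ} {g : ℕ} {F : Fin g → Submodule ℝ H}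
    (hF : IsLagFlag ω g F) {A : H →ₗ[ℝ] H} (hinj : Function.Injective A)
    (hA : ∀ u v, ω (A u) (A v) = ω u v) : IsLagFlag ω g fun i => (F i).map A := by
  refine ⟨fun i => ?_, fun i j hij => Submodule.map_mono (hF.2.1 i j hij), ?_⟩
  · rw [← hF.1 i]
    exact (Submodule.equivMapOfInjective A hinj (F i)).finrank_eq.symm
  · rintro i _ ⟨u, hu, rfl⟩ _ ⟨v, hv, rfl⟩
    rw [hA]
    exact hF.2.2 i u hu v hv

/-- The symplectic transvection `u ↦ u + c ω(u, w) w`. -/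
def sympTransvection (ω : H →ₗ[ℝ] H →ₗ[ℝ] ℝ) (c : ℝ) (w : H) : H →ₗ[ℝ] H :=
  LinearMap.id + c • (ω.flip w).smulRight w

theorem sympTransvection_apply (ω : H →ₗ[ℝ] H →ₗ[ℝ] ℝ) (c : ℝ) (w u : H) :
    sympTransvection ω c w u = u + c • ω u w • w := by
  simp [sympTransvection]

theorem sympTransvection_symplectic {ω : H →ₗ[ℝ] H →ₗ[ℝ] ℝ}
    (halt : ∀ u v : H, ω u v = - ω v u) (c : ℝ) (w u v : H) :
    ω (sympTransvection ω c w u) (sympTransvection ω c w v) = ω u v := by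
  have hw : ω w w = 0 := by linarith [halt w w]
  simp only [sympTransvection_apply, map_add, map_smul, LinearMap.add_apply,
    LinearMap.smul_apply, smul_eq_mul, hw, halt w v]
  ring

/-- Symplectic maps close to the identity move a nonzero vector to any nearby vector. -/
theorem exists_symplectic_family [FiniteDimensional ℝ H] {ω : H →ₗ[ℝ] H →ₗ[ℝ] ℝ}
    (halt : ∀ u v : H, ω u v = - ω v u) (hnd : ∀ u : H, (∀ v : H, ω u v = 0) → u = 0)
    {v : H} (hv : v ≠ 0) :
    ∃ A : H → H →L[ℝ] H, Tendsto A (𝓝 v) (𝓝 1) ∧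
      (∀ a u u', ω (A a u) (A a u') = ω u u') ∧ ∀ᶠ a in 𝓝 v, A a v = a := by
  obtain ⟨z, hz⟩ : ∃ z, ω z v ≠ 0 := by
    by_contra! h
    exact hv (hnd v fun u => by rw [halt, h, neg_zero])
  have hself : ∀ w, ω w w = 0 := fun w => by linarith [halt w w]
  have hcz : Continuous (ω z) := (ω z).continuous_of_finiteDimensional
  have hcu : ∀ u, Continuous (ω u) := fun u => (ω u).continuous_of_finiteDimensional
  set B : H →ₗ[ℝ] H := sympTransvection ω (-(ω z v)⁻¹) (v - z) with hB
  have hBv : B v = z := by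
    have h : ω v (v - z) = ω z v := by rw [map_sub, hself, halt v z]; ring
    rw [hB, sympTransvection_apply, h, smul_smul, neg_mul, inv_mul_cancel₀ hz]
    module
  have hBinv : ∀ u, sympTransvection ω (ω z v)⁻¹ (v - z) (B u) = u := fun u => by
    rw [hB, sympTransvection_apply, sympTransvection_apply]
    simp only [map_add, map_smul, LinearMap.add_apply, LinearMap.smul_apply, hself, smul_zero,
      add_zero]
    module
  refine ⟨fun a => (sympTransvection ω (ω z a)⁻¹ (a - z) ∘ₗ B).toContinuousLinearMap,
    ?_, fun a u u' => ?_, ?_⟩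
  · have hone : (1 : H →L[ℝ] H) =
        (sympTransvection ω (ω z v)⁻¹ (v - z) ∘ₗ B).toContinuousLinearMap := by
      ext u
      simp [hBinv]
    rw [hone]
    refine continuousAt_clm_apply.2 fun u => ?_
    simp only [LinearMap.coe_toContinuousLinearMap', LinearMap.comp_apply,
      sympTransvection_apply]
    have h1 : ContinuousAt (fun a => (ω z a)⁻¹) v := hcz.continuousAt.inv₀ hz
    have h2 : ContinuousAt (fun a => a - z) v := by fun_prop
    have h3 : ContinuousAt (fun a => ω (B u) (a - z)) v :=
      ((hcu (B u)).comp (by fun_prop : Continuous fun a : H => a - z)).continuousAt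
    exact continuousAt_const.add (h1.smul (h3.smul h2))
  · simp only [LinearMap.coe_toContinuousLinearMap', LinearMap.comp_apply]
    rw [sympTransvection_symplectic halt, hB, sympTransvection_symplectic halt]
  · filter_upwards [hcz.continuousAt.eventually_ne hz] with a ha
    simp only [LinearMap.coe_toContinuousLinearMap', LinearMap.comp_apply]
    rw [hBv, sympTransvection_apply, map_sub, hself, sub_zero, smul_smul, inv_mul_cancel₀ ha,
      one_smul, add_sub_cancel]

end Transvections

/-- The projection of the space of Lagrangian flags to projective space is open: if all flags
over the lines of `S` lie in the closed set `D`, so do the flags over limit lines of `S`. -/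
theorem IsLagFlag.mem_of_mem_closure {H : Type*} [NormedAddCommGroup H] [NormedSpace ℝ H]
    [FiniteDimensional ℝ H] {ω : H →ₗ[ℝ] H →ₗ[ℝ] ℝ} (halt : ∀ u v : H, ω u v = - ω v u)
    (hnd : ∀ u : H, (∀ v : H, ω u v = 0) → u = 0) {g : ℕ} {i₀ : Fin g}
    {D : Set (Fin g → Submodule ℝ H)} (hD : IsClosed D) {S : Set (Submodule ℝ H)}
    (hS1 : ∀ L ∈ S, finrank ℝ L = 1)
    (hS : ∀ F, IsLagFlag ω g F → F i₀ ∈ S → F ∈ D)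
    {F : Fin g → Submodule ℝ H} (hF : IsLagFlag ω g F) (hF1 : finrank ℝ (F i₀) = 1)
    (hFS : F i₀ ∈ closure S) : F ∈ D := by
  obtain ⟨v, hvF, hv1⟩ : ∃ v ∈ F i₀, ‖v‖ = 1 := by
    obtain ⟨⟨w, hwF⟩, hw0⟩ :=
      Module.finrank_pos_iff_exists_ne_zero.1 (hF1 ▸ one_pos : 0 < finrank ℝ (F i₀))
    have hw : ‖w‖ ≠ 0 := norm_ne_zero_iff.2 fun h => hw0 (Subtype.ext h)
    exact ⟨‖w‖⁻¹ • w, (F i₀).smul_mem _ hwF, by simp [norm_smul, hw]⟩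
  have hv : v ≠ 0 := norm_ne_zero_iff.1 (by rw [hv1]; exact one_ne_zero)
  obtain ⟨A, hA1, hAω, hAv⟩ := exists_symplectic_family halt hnd hv
  have hlim : Tendsto (fun a i => (F i).map (A a).toLinearMap) (𝓝 v) (𝓝 F) :=
    tendsto_pi_nhds.2 fun i => tendsto_map_of_tendsto_one hA1 (F i)
  refine hD.mem_of_frequently_of_tendsto ?_ hlim
  rw [Filter.frequently_iff]
  intro U hU
  obtain ⟨ε, hε, hball⟩ := Metric.mem_nhds_iff.1
    (inter_mem hU (inter_mem hAv (isOpen_ne.mem_nhds hv)))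
  obtain ⟨L, hLε, hLS⟩ := mem_closure_iff.1 hFS _ (isOpen_setOf_subDist_lt (F i₀) hε)
    (by rwa [Set.mem_ofPred_eq, ← dist_unitBallCompacts, dist_self])
  obtain ⟨a, haL, hav⟩ := exists_norm_sub_lt_of_subDist_lt hLε hvF hv1.le
  obtain ⟨haU, haA, ha0⟩ := hball (by rwa [Metric.mem_ball, dist_eq_norm])
  have hmem : a ∈ (F i₀).map (A a).toLinearMap := ⟨v, hvF, haA⟩
  have hinj : Function.Injective (A a).toLinearMap := injective_of_symplectic hnd (hAω a)
  refine ⟨a, haU, hS _ (hF.map hinj (hAω a)) ?_⟩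
  have hline : (F i₀).map (A a).toLinearMap = L := by
    have hspan : ∀ {K : Submodule ℝ H}, finrank ℝ K = 1 → a ∈ K → Submodule.span ℝ {a} = K :=
      fun {K} hK haK => Submodule.eq_of_le_of_finrank_eq
        ((Submodule.span_singleton_le_iff_mem _ _).2 haK) ((finrank_span_singleton ha0).trans hK.symm)
    rw [← hspan (hS1 L hLS) haL]
    refine (hspan ?_ hmem).symm
    rw [← hF1]
    exact (Submodule.equivMapOfInjective _ hinj (F i₀)).finrank_eq.symm
  rwa [hline]

/-- If a monoid acting symplectically on `(H, ω)` acts minimally on the projective space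
`ℙH`, and the stabilizer of some line `λ` acts minimally on the fiber of the Lagrangian
flag space over `λ` (canonically the Lagrangian flag space `ℒ(H^λ)` of the symplectic
reduction), then the monoid acts minimally on the space of Lagrangian flags `ℒ(H)`.
Minimality on `X`: every set closed in `X`, nonempty and invariant equals `X`. -/
theorem stmt7 {H : Type*} [NormedAddCommGroup H] [InnerProductSpace ℝ H]
    [FiniteDimensional ℝ H] (g : ℕ) (hg0 : 0 < g)
    (hdim : finrank ℝ H = 2 * g)
    (ω : H →ₗ[ℝ] H →ₗ[ℝ] ℝ)
    (halt : ∀ u v : H, ω u v = - ω v u)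
    (hnd : ∀ u : H, (∀ v : H, ω u v = 0) → u = 0)
    (M : Submonoid (H ≃ₗ[ℝ] H))
    (hM : ∀ x ∈ M, ∀ u v : H, ω (x u) (x v) = ω u v)
    -- minimality of the action of `M` on `ℙ H`
    (hminP : ∀ C : Set (Submodule ℝ H), C ⊆ {L : Submodule ℝ H | finrank ℝ L = 1} →
      (∃ D : Set (Submodule ℝ H), IsClosed D ∧ C = D ∩ {L : Submodule ℝ H | finrank ℝ L = 1}) →
      C.Nonempty →
      (∀ x ∈ M, (fun L : Submodule ℝ H => Submodule.map x.toLinearMap L) '' C = C) →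
      C = {L : Submodule ℝ H | finrank ℝ L = 1})
    -- a line `λ` whose stabilizer in `M` acts minimally on the fiber of `ℒ(H)` over `λ`,
    -- which is canonically identified with `ℒ(H^λ)`
    (lam : Submodule ℝ H) (hlam : finrank ℝ lam = 1)
    (hminFiber : ∀ C : Set (Fin g → Submodule ℝ H),
      C ⊆ {F | IsLagFlag ω g F ∧ F ⟨0, hg0⟩ = lam} →
      (∃ D : Set (Fin g → Submodule ℝ H), IsClosed D ∧
        C = D ∩ {F | IsLagFlag ω g F ∧ F ⟨0, hg0⟩ = lam}) →
      C.Nonempty →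
      (∀ x ∈ M, Submodule.map x.toLinearMap lam = lam →
        (fun F : Fin g → Submodule ℝ H => fun i => Submodule.map x.toLinearMap (F i)) '' C = C) →
      C = {F | IsLagFlag ω g F ∧ F ⟨0, hg0⟩ = lam}) :
    -- conclusion: `M` acts minimally on `ℒ(H)`
    ∀ C : Set (Fin g → Submodule ℝ H), C ⊆ {F | IsLagFlag ω g F} →
      (∃ D : Set (Fin g → Submodule ℝ H), IsClosed D ∧ C = D ∩ {F | IsLagFlag ω g F}) →
      C.Nonempty →
      (∀ x ∈ M, (fun F : Fin g → Submodule ℝ H => fun i => Submodule.map x.toLinearMap (F i)) '' C = C) →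
      C = {F | IsLagFlag ω g F} := by
  intro C hCsub hCD hCne hCM
  obtain ⟨D, hD, hCeq⟩ := hCD
  set i₀ : Fin g := ⟨0, hg0⟩
  have hline : ∀ F, IsLagFlag ω g F → finrank ℝ (F i₀) = 1 := fun F hF => hF.1 i₀
  have hmapinj : ∀ x : H ≃ₗ[ℝ] H, Function.Injective (Submodule.map x.toLinearMap) := fun x =>
    Submodule.map_injective_of_injective x.injective
  have hsymm : ∀ (x : H ≃ₗ[ℝ] H) (L : Submodule ℝ H),
      (L.map x.symm.toLinearMap).map x.toLinearMap = L := fun x L => by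
    rw [← Submodule.map_comp]
    simp
  have hflag : ∀ x ∈ M, ∀ F, IsLagFlag ω g F → IsLagFlag ω g fun i => (F i).map x.toLinearMap :=
    fun x hx F hF => hF.map x.injective (hM x hx)
  have hflag' : ∀ x ∈ M, ∀ F, IsLagFlag ω g F →
      IsLagFlag ω g fun i => (F i).map x.symm.toLinearMap := fun x hx F hF =>
    hF.map x.symm.injective fun u v => by simpa using (hM x hx (x.symm u) (x.symm v)).symm
  have hproj : (fun F : Fin g → Submodule ℝ H => F i₀) '' C = {L : Submodule ℝ H | finrank ℝ L = 1} := by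
    have hsub : (fun F : Fin g → Submodule ℝ H => F i₀) '' C ⊆ {L : Submodule ℝ H | finrank ℝ L = 1} := by
      rintro _ ⟨F, hF, rfl⟩
      exact hline F (hCsub hF)
    have hcpt : IsCompact C := hCeq ▸ (isCompact_setOf_isLagFlag g ω).inter_left hD
    refine hminP _ hsub ⟨_, (hcpt.image (continuous_apply i₀)).isClosed,
      (Set.inter_eq_left.2 hsub).symm⟩ (hCne.image _) fun x hx => ?_
    conv_rhs => rw [← hCM x hx]
    rw [Set.image_image, Set.image_image]
  have hfiber : ∀ F, IsLagFlag ω g F → F i₀ = lam → F ∈ C := by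
    have hEq := hminFiber (C ∩ {F | F i₀ = lam}) (fun F hF => ⟨hCsub hF.1, hF.2⟩)
      ⟨D, hD, by rw [hCeq]; ext F; simp [and_assoc]⟩
      (by
        obtain ⟨F, hF, hFl⟩ : lam ∈ (fun F : Fin g → Submodule ℝ H => F i₀) '' C :=
          hproj ▸ hlam
        exact ⟨F, hF, hFl⟩)
      (fun x hx hxl => by
        ext F
        constructor
        · rintro ⟨G, ⟨hG, hGl⟩, rfl⟩
          refine ⟨hCM x hx ▸ ⟨G, hG, rfl⟩, ?_⟩
          change (G i₀).map x.toLinearMap = lam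
          rw [show G i₀ = lam from hGl, hxl]
        · rintro ⟨hF, hFl⟩
          rw [← hCM x hx] at hF
          obtain ⟨G, hG, rfl⟩ := hF
          exact ⟨G, ⟨hG, hmapinj x (Eq.trans hFl hxl.symm)⟩, rfl⟩)
    intro F hF hFl
    have hmem : F ∈ {F | IsLagFlag ω g F ∧ F ⟨0, hg0⟩ = lam} := ⟨hF, hFl⟩
    rw [← hEq] at hmem
    exact hmem.1
  set S : Set (Submodule ℝ H) :=
    {L | finrank ℝ L = 1 ∧ ∀ F, IsLagFlag ω g F → F i₀ = L → F ∈ C}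
  have hSsub : S ⊆ {L : Submodule ℝ H | finrank ℝ L = 1} := fun L hL => hL.1
  have hSall : S = {L : Submodule ℝ H | finrank ℝ L = 1} := by
    refine hminP S hSsub ⟨closure S, isClosed_closure, ?_⟩ ⟨lam, hlam, hfiber⟩ fun x hx => ?_
    · refine Set.Subset.antisymm (fun L hL => ⟨subset_closure hL, hL.1⟩) ?_
      rintro L ⟨hLS, hL1⟩
      refine ⟨hL1, ?_⟩
      rintro F hF rfl
      rw [hCeq]
      refine ⟨hF.mem_of_mem_closure halt hnd hD hSsub (fun G hG hGS => ?_) hL1 hLS, hF⟩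
      have hGC := hGS.2 G hG rfl
      rw [hCeq] at hGC
      exact hGC.1
    · ext L
      constructor
      · rintro ⟨K, ⟨hK1, hK⟩, rfl⟩
        refine ⟨(x.submoduleMap K).finrank_eq.symm.trans hK1, fun F hF hFK => ?_⟩
        rw [← hCM x hx]
        refine ⟨fun i => (F i).map x.symm.toLinearMap, hK _ (hflag' x hx F hF) ?_,
          funext fun i => hsymm x (F i)⟩
        exact hmapinj x ((hsymm x (F i₀)).trans hFK)
      · rintro ⟨hL1, hL⟩
        refine ⟨L.map x.symm.toLinearMap,
          ⟨(x.symm.submoduleMap L).finrank_eq.symm.trans hL1, fun F hF hFL => ?_⟩, hsymm x L⟩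
        have hxF := hL _ (hflag x hx F hF) (by rw [hFL, hsymm])
        rw [← hCM x hx] at hxF
        obtain ⟨G, hG, hGF⟩ := hxF
        have : G = F := funext fun i => hmapinj x (congrFun hGF i)
        exact this ▸ hG
  refine Set.Subset.antisymm hCsub fun F hF => ?_
  have hFS : F i₀ ∈ S := hSall ▸ hline F hF
  exact hFS.2 F hF rfl
end

section
/- A monoid ℬ acting linearly on a vector space H twists a subspace F ∈ Grass(k,H) if and only if F does not belong to any non-trivial ℬ-invariant linear arrangement in Grass(k,H). -/
open Module

/-- A linear arrangement in the Grassmannian `Grass(k,H)`: a finite union of finite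
intersections of hyperplane sections (the hyperplane section dual to
`E ∈ Grass(dim H − k, H)` being `{F : F ⊓ E ≠ ⊥}`), intersected with `Grass(k,H)`. -/
def IsLinArrangement {H : Type*} [AddCommGroup H] [Module ℝ H] [FiniteDimensional ℝ H]
    (k : ℕ) (S : Set (Submodule ℝ H)) : Prop :=
  ∃ 𝒥 : Finset (Finset (Submodule ℝ H)),
    (∀ J ∈ 𝒥, ∀ E ∈ J, finrank ℝ E = finrank ℝ H - k) ∧
    S = {F : Submodule ℝ H | finrank ℝ F = k} ∩
        ⋃ J ∈ 𝒥, ⋂ E ∈ (J : Set (Submodule ℝ H)), {F : Submodule ℝ H | F ⊓ E ≠ ⊥}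

/-- The monoid `ℬ` twists `F ∈ Grass(k,H)`: for any finite family of subspaces of
complementary dimension, some element of `ℬ` maps `F` transversally to all of them. -/
def Twists {H : Type*} [AddCommGroup H] [Module ℝ H] [FiniteDimensional ℝ H]
    (ℬ : Set (H ≃ₗ[ℝ] H)) (k : ℕ) (F : Submodule ℝ H) : Prop :=
  ∀ 𝒢 : Finset (Submodule ℝ H), (∀ G ∈ 𝒢, finrank ℝ G = finrank ℝ H - k) →
    ∃ x ∈ ℬ, ∀ G ∈ 𝒢, Submodule.map x.toLinearMap F ⊓ G = ⊥

section LinearArrangements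

variable {H : Type*} [AddCommGroup H] [Module ℝ H] [FiniteDimensional ℝ H] {k : ℕ}

/-- Finitely many subspaces of codimension at least `k` are all transverse to a common subspace of
dimension `k`. -/
theorem exists_finrank_eq_forall_inf_eq_bot (k d : ℕ) (hd : d + k = finrank ℝ H)
    (𝒢 : Finset (Submodule ℝ H)) (h𝒢 : ∀ G ∈ 𝒢, finrank ℝ G ≤ d) :
    ∃ F : Submodule ℝ H, finrank ℝ F = k ∧ ∀ G ∈ 𝒢, F ⊓ G = ⊥ := by
  classical
  induction k generalizing d 𝒢 with
  | zero => exact ⟨⊥, finrank_bot ℝ H, fun G _ => bot_inf_eq G⟩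
  | succ k ih =>
    -- Adding `⊥` to the family makes the chosen vector nonzero.
    have h𝒢' : ∀ G ∈ insert ⊥ 𝒢, finrank ℝ G ≤ d := by
      intro G hG
      rcases Finset.mem_insert.1 hG with rfl | hG
      · simp
      · exact h𝒢 G hG
    have htop : (⊤ : Submodule ℝ H) ∉ insert ⊥ 𝒢 := by
      intro h
      have := h𝒢' _ h
      rw [finrank_top] at this
      omega
    obtain ⟨w, hw⟩ := (Set.ne_univ_iff_exists_notMem _).1
      (Subspace.biUnion_ne_univ_of_top_notMem htop)
    simp only [Set.mem_iUnion, not_exists] at hw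
    have hw0 : w ≠ 0 := by
      simpa using hw ⊥ (Finset.mem_insert_self _ _)
    have hdisj : ∀ G : Submodule ℝ H, w ∉ G → Disjoint G (ℝ ∙ w) := fun G hG =>
      (Submodule.disjoint_span_singleton' hw0).2 hG
    have hsup : ∀ G : Submodule ℝ H, w ∉ G → finrank ℝ (G ⊔ ℝ ∙ w : Submodule ℝ H) =
        finrank ℝ G + 1 := by
      intro G hG
      have h := Submodule.finrank_sup_add_finrank_inf_eq G (ℝ ∙ w)
      rw [(hdisj G hG).eq_bot, finrank_bot, finrank_span_singleton hw0] at h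
      simpa using h
    obtain ⟨F, hF, hFG⟩ := ih (d + 1) (by omega) ((insert ⊥ 𝒢).image (· ⊔ ℝ ∙ w)) (by
      rw [Finset.forall_mem_image]
      intro G hG
      rw [hsup G (hw G hG)]
      exact Nat.succ_le_succ (h𝒢' G hG))
    rw [Finset.forall_mem_image] at hFG
    have hwF : w ∉ F := by
      have := hFG (Finset.mem_insert_self _ _)
      rwa [bot_sup_eq, ← disjoint_iff, Submodule.disjoint_span_singleton' hw0] at this
    refine ⟨F ⊔ ℝ ∙ w, by rw [hsup F hwF, hF], fun G hG => ?_⟩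
    have hG' := Finset.mem_insert_of_mem (b := ⊥) hG
    rw [← disjoint_iff, sup_comm, disjoint_comm]
    exact (hdisj G (hw G hG')).disjoint_sup_right_of_disjoint_sup_left
      (disjoint_iff.2 (hFG hG')).symm

theorem IsLinArrangement.finrank_eq {S : Set (Submodule ℝ H)} (hS : IsLinArrangement k S)
    {F : Submodule ℝ H} (hF : F ∈ S) : finrank ℝ F = k := by
  obtain ⟨𝒥, -, rfl⟩ := hS
  exact hF.1

theorem IsLinArrangement.inter {S T : Set (Submodule ℝ H)} (hS : IsLinArrangement k S)
    (hT : IsLinArrangement k T) : IsLinArrangement k (S ∩ T) := by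
  classical
  obtain ⟨𝒥, h𝒥, rfl⟩ := hS
  obtain ⟨𝒦, h𝒦, rfl⟩ := hT
  refine ⟨(𝒥 ×ˢ 𝒦).image fun p => p.1 ∪ p.2, ?_, ?_⟩
  · intro L hL E hE
    obtain ⟨⟨J, K⟩, hp, rfl⟩ := Finset.mem_image.1 hL
    rw [Finset.mem_product] at hp
    rcases Finset.mem_union.1 hE with h | h
    · exact h𝒥 J hp.1 E h
    · exact h𝒦 K hp.2 E h
  · ext F
    simp only [Set.mem_inter_iff, Set.mem_ofPred_eq, Set.mem_iUnion, Set.mem_iInter,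
      Finset.mem_coe, exists_prop]
    constructor
    · rintro ⟨⟨hF, J, hJ, hFJ⟩, -, K, hK, hFK⟩
      refine ⟨hF, J ∪ K, Finset.mem_image.2 ⟨(J, K), Finset.mem_product.2 ⟨hJ, hK⟩, rfl⟩, ?_⟩
      intro E hE
      exact (Finset.mem_union.1 hE).elim (hFJ E) (hFK E)
    · rintro ⟨hF, L, hL, hFL⟩
      obtain ⟨⟨J, K⟩, hp, rfl⟩ := Finset.mem_image.1 hL
      rw [Finset.mem_product] at hp
      exact ⟨⟨hF, J, hp.1, fun E hE => hFL E (Finset.mem_union_left _ hE)⟩,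
        hF, K, hp.2, fun E hE => hFL E (Finset.mem_union_right _ hE)⟩

theorem IsLinArrangement.preimage_map {S : Set (Submodule ℝ H)} (hS : IsLinArrangement k S)
    (x : H ≃ₗ[ℝ] H) :
    IsLinArrangement k ((fun F : Submodule ℝ H => F.map x.toLinearMap) ⁻¹' S) := by
  classical
  obtain ⟨𝒥, h𝒥, rfl⟩ := hS
  have hmap : ∀ F E : Submodule ℝ H,
      F ⊓ E.map x.symm.toLinearMap = ⊥ ↔ F.map x.toLinearMap ⊓ E = ⊥ := by
    intro F E
    have : F.map x.toLinearMap ⊓ E =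
        (F ⊓ E.map x.symm.toLinearMap).map x.toLinearMap := by
      rw [Submodule.map_inf _ x.injective, ← Submodule.map_comp]
      simp
    rw [this, Submodule.map_eq_bot_iff]
  refine ⟨𝒥.image fun J => J.image fun E => E.map x.symm.toLinearMap, ?_, ?_⟩
  · simp only [Finset.forall_mem_image]
    intro J hJ E hE
    rw [← h𝒥 J hJ E hE]
    exact LinearEquiv.finrank_map_eq x.symm E
  · ext F
    have hfin : finrank ℝ (F.map x.toLinearMap) = finrank ℝ F := LinearEquiv.finrank_map_eq x F
    simp only [Set.mem_preimage, Set.mem_inter_iff, Set.mem_ofPred_eq, Set.mem_iUnion,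
      Set.mem_iInter, Finset.mem_coe, exists_prop, hfin, Finset.exists_mem_image,
      Finset.forall_mem_image, ne_eq, hmap]

/-- The algebra of polynomial functions on `k`-tuples of vectors of `H`. -/
def tuplePolynomials (k : ℕ) (H : Type*) [AddCommGroup H] [Module ℝ H] [FiniteDimensional ℝ H] :
    Subalgebra ℝ ((Fin k → H) → ℝ) :=
  Algebra.adjoin ℝ (Set.range fun (p : Fin k × Fin (finrank ℝ H)) (v : Fin k → H) =>
    (finBasis ℝ H).repr (v p.1) p.2)

instance : IsNoetherianRing (tuplePolynomials k H) :=
  isNoetherianRing_of_fg (Subalgebra.fg_def.2 ⟨_, Set.finite_range _, rfl⟩)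

theorem dual_apply_mem_tuplePolynomials (i : Fin k) (f : H →ₗ[ℝ] ℝ) :
    (fun v : Fin k → H => f (v i)) ∈ tuplePolynomials k H := by
  have : (fun v : Fin k → H => f (v i)) = ∑ j, f (finBasis ℝ H j) •
      fun v : Fin k → H => (finBasis ℝ H).repr (v i) j := by
    ext v
    conv_lhs => rw [← (finBasis ℝ H).sum_repr (v i), map_sum]
    simp [-Basis.sum_repr, mul_comm]
  rw [this]
  exact Subalgebra.sum_mem _ fun j _ =>
    Subalgebra.smul_mem _ (Algebra.subset_adjoin (Set.mem_range_self (i, j))) _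

/-- Transversality to a subspace of complementary dimension is the nonvanishing of a polynomial
in the vectors of a basis. -/
theorem exists_tuplePolynomial_ne_zero_iff (hk : k ≤ finrank ℝ H) (E : Submodule ℝ H)
    (hE : finrank ℝ E = finrank ℝ H - k) :
    ∃ a : tuplePolynomials k H, ∀ v : Fin k → H, LinearIndependent ℝ v →
      (a.1 v ≠ 0 ↔ Submodule.span ℝ (Set.range v) ⊓ E = ⊥) := by
  have hquot : finrank ℝ (H ⧸ E) = finrank ℝ (Fin k → ℝ) := by
    have := E.finrank_quotient_add_finrank
    rw [finrank_fin_fun]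
    omega
  let e : (H ⧸ E) ≃ₗ[ℝ] (Fin k → ℝ) := LinearEquiv.ofFinrankEq _ _ hquot
  let φ : H →ₗ[ℝ] (Fin k → ℝ) := e.toLinearMap ∘ₗ E.mkQ
  have hφ : LinearMap.ker φ = E := by
    rw [LinearEquiv.ker_comp, Submodule.ker_mkQ]
  refine ⟨⟨fun v => (Matrix.of fun i j => φ (v i) j).det, ?_⟩, fun v hv => ?_⟩
  · have : (fun v : Fin k → H => (Matrix.of fun i j => φ (v i) j).det) =
        ∑ σ : Equiv.Perm (Fin k), ((Equiv.Perm.sign σ : ℤ) : ℝ) •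
          ∏ i, fun v : Fin k → H => (LinearMap.proj i ∘ₗ φ) (v (σ i)) := by
      ext v
      simp [Matrix.det_apply']
    rw [this]
    exact Subalgebra.sum_mem _ fun σ _ => Subalgebra.smul_mem _
      (Subalgebra.prod_mem _ fun i _ => dual_apply_mem_tuplePolynomials _ _) _
  · have hrow : (Matrix.of fun i j => φ (v i) j).row = φ ∘ v := rfl
    change (Matrix.of fun i j => φ (v i) j).det ≠ 0 ↔ _
    rw [← isUnit_iff_ne_zero, ← Matrix.isUnit_iff_isUnit_det,
      ← Matrix.linearIndependent_rows_iff_isUnit, hrow, ← disjoint_iff]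
    constructor
    · intro h
      simpa only [hφ] using Submodule.range_ker_disjoint h
    · intro h
      exact hv.map (by rwa [hφ])

/-- The polynomial functions vanishing at every basis of every member of `S`. -/
def vanishingTuplePolynomials (k : ℕ) (S : Set (Submodule ℝ H)) : Ideal (tuplePolynomials k H) where
  carrier := {a | ∀ v : Fin k → H, LinearIndependent ℝ v → Submodule.span ℝ (Set.range v) ∈ S →
    a.1 v = 0}
  add_mem' ha hb v hv hS := by simp [ha v hv hS, hb v hv hS]
  zero_mem' _ _ _ := rfl
  smul_mem' c a ha v hv hS := by simp [ha v hv hS]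

theorem vanishingTuplePolynomials_lt {S T : Set (Submodule ℝ H)} (hk : k ≤ finrank ℝ H)
    (hS : IsLinArrangement k S) (hT : IsLinArrangement k T) (hST : S ⊂ T) :
    vanishingTuplePolynomials k T < vanishingTuplePolynomials k S := by
  classical
  refine SetLike.lt_iff_le_and_exists.2 ⟨fun a ha v hv hvS => ha v hv (hST.1 hvS), ?_⟩
  obtain ⟨F, hFT, hFS⟩ := Set.exists_of_ssubset hST
  have hF := hT.finrank_eq hFT
  obtain ⟨𝒥, h𝒥, rfl⟩ := hS
  have hsel : ∀ J ∈ 𝒥, ∃ E ∈ J, F ⊓ E = ⊥ := by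
    intro J hJ
    by_contra! h
    exact hFS ⟨hF, Set.mem_biUnion hJ (Set.mem_iInter₂.2 h)⟩
  choose! E hEJ hFE using hsel
  choose! a ha using fun J (hJ : J ∈ 𝒥) =>
    exists_tuplePolynomial_ne_zero_iff hk (E J) (h𝒥 J hJ _ (hEJ J hJ))
  have hprod : ∀ v, (∏ J ∈ 𝒥, a J).1 v = ∏ J ∈ 𝒥, (a J).1 v := by
    intro v
    simp
  refine ⟨∏ J ∈ 𝒥, a J, fun v hv hvS => ?_, fun h => ?_⟩
  · obtain ⟨J, hJ, hvJ⟩ := Set.mem_iUnion₂.1 hvS.2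
    rw [hprod]
    refine Finset.prod_eq_zero hJ ?_
    by_contra hne
    exact Set.mem_iInter₂.1 hvJ (E J) (hEJ J hJ) ((ha J hJ v hv).1 hne)
  · let b := finBasisOfFinrankEq ℝ F hF
    have hv : LinearIndependent ℝ (F.subtype ∘ b) :=
      b.linearIndependent.map' _ F.ker_subtype
    have hspan : Submodule.span ℝ (Set.range (F.subtype ∘ b)) = F := by
      rw [Set.range_comp, Submodule.span_image, b.span_eq, Submodule.map_top, F.range_subtype]
    have h0 := h _ hv (by rwa [hspan])
    rw [hprod] at h0
    refine Finset.prod_ne_zero_iff.2 (fun J hJ => ?_) h0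
    rw [ha J hJ _ hv, hspan]
    exact hFE J hJ

/-- Every nonempty family of linear arrangements has a minimal member. -/
theorem exists_minimal_isLinArrangement (hk : k ≤ finrank ℝ H)
    (𝒮 : Set (Set (Submodule ℝ H))) (h𝒮 : ∀ S ∈ 𝒮, IsLinArrangement k S) (hne : 𝒮.Nonempty) :
    ∃ S ∈ 𝒮, ∀ T ∈ 𝒮, T ⊆ S → T = S := by
  obtain ⟨_, ⟨S, hS, rfl⟩, hmax⟩ := WellFounded.has_min
    (wellFounded_gt (α := Ideal (tuplePolynomials k H)))
    (vanishingTuplePolynomials k '' 𝒮) (hne.image _)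
  refine ⟨S, hS, fun T hT hTS => ?_⟩
  by_contra hTS_ne
  exact hmax _ ⟨T, hT, rfl⟩
    (vanishingTuplePolynomials_lt hk (h𝒮 T hT) (h𝒮 S hS) (hTS.ssubset_of_ne hTS_ne))

/-- A linear arrangement mapped into itself by an automorphism is mapped onto itself. -/
theorem IsLinArrangement.image_map_eq (hk : k ≤ finrank ℝ H) {S : Set (Submodule ℝ H)}
    (hS : IsLinArrangement k S) (x : H ≃ₗ[ℝ] H)
    (hxS : ∀ F ∈ S, F.map x.toLinearMap ∈ S) :
    (fun F : Submodule ℝ H => F.map x.toLinearMap) '' S = S := by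
  let f : Submodule ℝ H ≃ Submodule ℝ H := (Submodule.orderIsoMapComap x).toEquiv
  have himage : ∀ n : ℕ, IsLinArrangement k ((f '' ·)^[n] S) := by
    intro n
    induction n with
    | zero => exact hS
    | succ n ih =>
      rw [Function.iterate_succ_apply', Equiv.image_eq_preimage_symm]
      convert ih.preimage_map x.symm using 2
      ext1 F
      exact (Submodule.map_equiv_eq_comap_symm x.symm F).symm
  obtain ⟨_, ⟨n, rfl⟩, hmin⟩ := exists_minimal_isLinArrangement hk
    (Set.range fun n : ℕ => (f '' ·)^[n] S) (by rintro _ ⟨n, rfl⟩; exact himage n)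
    (Set.range_nonempty _)
  have hmono : Monotone fun T : Set (Submodule ℝ H) => f '' T := fun _ _ h => Set.image_mono h
  have hsub : f '' S ⊆ S := by
    rintro _ ⟨F, hF, rfl⟩
    exact hxS F hF
  have heq := hmin _ ⟨n + 1, rfl⟩ (by
    simp only [Function.iterate_succ_apply]
    exact hmono.iterate n hsub)
  simp only [Function.iterate_succ_apply] at heq
  exact (Set.image_injective.2 f.injective).iterate n heq

theorem not_mem_invariant_of_twists {M : Set (H ≃ₗ[ℝ] H)} {F : Submodule ℝ H}
    (hM : Twists M k F) {S : Set (Submodule ℝ H)} (hS : IsLinArrangement k S)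
    (hne : S ≠ {F' : Submodule ℝ H | finrank ℝ F' = k})
    (hinv : ∀ x ∈ M, ∀ F' ∈ S, F'.map x.toLinearMap ∈ S) : F ∉ S := by
  classical
  intro hFS
  obtain ⟨𝒥, h𝒥, rfl⟩ := hS
  have hJne : ∀ J ∈ 𝒥, ∃ E, E ∈ J := by
    intro J hJ
    by_contra! h
    refine hne (Set.inter_eq_left.2 fun F' _ => Set.mem_biUnion hJ (Set.mem_iInter₂.2 ?_))
    exact fun E hE => absurd hE (h E)
  choose! E hE using hJne
  obtain ⟨x, hx, hxE⟩ := hM (𝒥.image E) (by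
    simp only [Finset.forall_mem_image]
    exact fun J hJ => h𝒥 J hJ _ (hE J hJ))
  obtain ⟨J, hJ, hxJ⟩ := Set.mem_iUnion₂.1 (hinv x hx F hFS).2
  exact Set.mem_iInter₂.1 hxJ (E J) (hE J hJ) (hxE _ (Finset.mem_image_of_mem E hJ))

theorem exists_invariant_of_not_twists (hk : k ≤ finrank ℝ H) {M : Submonoid (H ≃ₗ[ℝ] H)}
    {F : Submodule ℝ H} (hF : finrank ℝ F = k) (hM : ¬ Twists (M : Set (H ≃ₗ[ℝ] H)) k F) :
    ∃ S : Set (Submodule ℝ H), IsLinArrangement k S ∧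
      S ≠ {F' : Submodule ℝ H | finrank ℝ F' = k} ∧
      (∀ x ∈ M, ∀ F' ∈ S, F'.map x.toLinearMap ∈ S) ∧ F ∈ S := by
  classical
  simp only [Twists, not_forall, not_exists, not_and] at hM
  obtain ⟨𝒢, h𝒢, hM⟩ := hM
  let S₀ : Set (Submodule ℝ H) :=
    {F' | finrank ℝ F' = k} ∩ {F' | ∃ G ∈ 𝒢, F' ⊓ G ≠ ⊥}
  have hS₀ : IsLinArrangement k S₀ := by
    refine ⟨𝒢.image singleton, ?_, ?_⟩
    · simpa using h𝒢
    · ext F'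
      simp [S₀]
  obtain ⟨S, ⟨hS, horbit⟩, hmin⟩ := exists_minimal_isLinArrangement hk
    {S | IsLinArrangement k S ∧ ∀ x ∈ M, F.map x.toLinearMap ∈ S} (fun S h => h.1)
    ⟨S₀, hS₀, fun x hx => ⟨(LinearEquiv.finrank_map_eq x F).trans hF, by simpa using hM x hx⟩⟩
  have hSS₀ : S ⊆ S₀ := by
    refine Set.inter_eq_left.1 (hmin _ ⟨hS.inter hS₀, fun x hx => ⟨horbit x hx, ?_⟩⟩
      Set.inter_subset_left)
    exact ⟨(LinearEquiv.finrank_map_eq x F).trans hF, by simpa using hM x hx⟩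
  refine ⟨S, hS, fun h => ?_, fun x hx => ?_, ?_⟩
  · obtain ⟨F', hF', hF'G⟩ :=
      exists_finrank_eq_forall_inf_eq_bot k (finrank ℝ H - k) (by omega) 𝒢
        fun G hG => (h𝒢 G hG).le
    obtain ⟨G, hG, hne⟩ := (hSS₀ (h ▸ hF' : F' ∈ S)).2
    exact hne (hF'G G hG)
  · refine Set.inter_eq_left.1 (hmin _ ⟨hS.inter (hS.preimage_map x), fun y hy =>
      ⟨horbit y hy, ?_⟩⟩ Set.inter_subset_left)
    change (F.map y.toLinearMap).map x.toLinearMap ∈ S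
    rw [← Submodule.map_comp]
    exact horbit (x * y) (M.mul_mem hx hy)
  · have := horbit 1 M.one_mem
    have hid : F.map (1 : H ≃ₗ[ℝ] H).toLinearMap = F := Submodule.map_id F
    rwa [hid] at this

end LinearArrangements

/-- A monoid twists `F ∈ Grass(k,H)` if and only if `F` lies in no non-trivial
invariant linear arrangement in `Grass(k,H)`. -/
theorem stmt12 {H : Type*} [AddCommGroup H] [Module ℝ H] [FiniteDimensional ℝ H]
    (k : ℕ) (hk1 : 1 ≤ k) (hk2 : k ≤ finrank ℝ H - 1)
    (M : Submonoid (H ≃ₗ[ℝ] H))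
    (F : Submodule ℝ H) (hF : finrank ℝ F = k) :
    Twists (M : Set (H ≃ₗ[ℝ] H)) k F ↔
      ¬ ∃ S : Set (Submodule ℝ H), IsLinArrangement k S ∧
          S.Nonempty ∧ S ≠ {F' : Submodule ℝ H | finrank ℝ F' = k} ∧
          (∀ x ∈ M, (fun F' : Submodule ℝ H => Submodule.map x.toLinearMap F') '' S = S) ∧
          F ∈ S := by
  have hk : k ≤ finrank ℝ H := hk2.trans (Nat.sub_le _ _)
  constructor
  · rintro hM ⟨S, hS, -, hne, hinv, hFS⟩
    exact not_mem_invariant_of_twists hM hS hne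
      (fun x hx F' hF' => (hinv x hx).subset ⟨F', hF', rfl⟩) hFS
  · intro h
    by_contra hM
    obtain ⟨S, hS, hne, hinv, hFS⟩ := exists_invariant_of_not_twists hk hF hM
    exact h ⟨S, hS, ⟨F, hFS⟩, hne, fun x hx => hS.image_map_eq hk x (hinv x hx), hFS⟩
end

section
/- Let ℬ be a monoid acting symplectically on a symplectic space (H, ω) of dimension 2g such that the induced action on the space of Lagrangian flags ℒ(H) (equivalently, on each Iso(k,H), 1 ≤ k ≤ g) is minimal. Then ℬ twists every isotropic subspace: for every isotropic F ∈ Iso(k,H) and every finite family {F_i} of (2g−k)-dimensional subspaces, there exists x ∈ ℬ with (x·F) ∩ F_i = {0} for all i. -/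
open Module

/-- The set `Iso(k,H)` of isotropic `k`-dimensional subspaces. -/
def IsoGrass {H : Type*} [NormedAddCommGroup H] [NormedSpace ℝ H]
    (ω : H →ₗ[ℝ] H →ₗ[ℝ] ℝ) (k : ℕ) : Set (Submodule ℝ H) :=
  {F | finrank ℝ F = k ∧ ∀ u ∈ F, ∀ v ∈ F, ω u v = 0}

section Avoidance

variable {K H : Type*} [Field K] [Infinite K] [AddCommGroup H] [Module K H]

/-- A subspace contained in none of finitely many subspaces contains a vector avoiding all of
them. -/
theorem Submodule.exists_mem_forall_notMem_of_not_le (V : Submodule K H)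
    (s : Finset (Submodule K H)) (hs : ∀ E ∈ s, ¬ V ≤ E) : ∃ v ∈ V, ∀ E ∈ s, v ∉ E := by
  by_contra! hcon
  have hcover : ⋃ E : s, ((E : Submodule K H).comap V.subtype : Set V) = Set.univ := by
    refine Set.eq_univ_of_forall fun v => ?_
    obtain ⟨E, hE, hv⟩ := hcon v v.2
    exact Set.mem_iUnion.2 ⟨⟨E, hE⟩, hv⟩
  obtain ⟨E, hE⟩ := Subspace.exists_eq_top_of_iUnion_eq_univ hcover
  refine hs E E.2 fun v hv => ?_
  have : (⟨v, hv⟩ : V) ∈ (E : Submodule K H).comap V.subtype := hE ▸ Submodule.mem_top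
  exact this

end Avoidance

section Isotropic

variable {K H : Type*} [Field K] [Infinite K] [AddCommGroup H] [Module K H]
  [FiniteDimensional K H] {B : LinearMap.BilinForm K H}

/-- The extension step for isotropic subspaces avoiding a family of subspaces stable under
taking orthogonals. -/
theorem LinearMap.BilinForm.exists_mem_orthogonal_forall_notMem_sup (hB : B.Nondegenerate)
    (hrefl : B.IsRefl) (s : Finset (Submodule K H)) (hs : ∀ E ∈ s, B.orthogonal E ∈ s)
    (L : Submodule K H) (hdim : ∀ E ∈ s, finrank K L + finrank K E < finrank K H)
    (hL : ∀ E ∈ s, L ⊓ E = ⊥) : ∃ v ∈ B.orthogonal L, ∀ E ∈ s, v ∉ L ⊔ E := by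
  classical
  obtain ⟨v, hv, hvE⟩ := (B.orthogonal L).exists_mem_forall_notMem_of_not_le
    (s.image fun E => L ⊔ E) (fun E' hE' hle => by
      obtain ⟨E, hE, rfl⟩ := Finset.mem_image.1 hE'
      have hEL : B.orthogonal L ⊓ B.orthogonal E ≤ L := by
        intro w hw
        rw [← LinearMap.BilinForm.orthogonal_orthogonal hB hrefl L]
        intro u hu
        obtain ⟨a, ha, b, hb, rfl⟩ := Submodule.mem_sup.1 (hle hu)
        have h1 : B a w = 0 := hw.1 a ha
        have h2 : B b w = 0 := hw.2 b hb
        change B (a + b) w = 0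
        simp [h1, h2]
      have hbot : B.orthogonal L ⊓ B.orthogonal E = ⊥ :=
        le_bot_iff.1 ((le_inf hEL inf_le_right).trans (hL _ (hs E hE)).le)
      have h1 := Submodule.finrank_sup_add_finrank_inf_eq (B.orthogonal L) (B.orthogonal E)
      have h2 := Submodule.finrank_le (B.orthogonal L ⊔ B.orthogonal E)
      have h3 := LinearMap.BilinForm.finrank_orthogonal hB L
      have h4 := LinearMap.BilinForm.finrank_orthogonal hB E
      have h5 := hdim E hE
      rw [hbot, finrank_bot] at h1
      omega)
  exact ⟨v, hv, fun E hE => hvE _ (Finset.mem_image_of_mem _ hE)⟩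

/-- Isotropic subspaces transverse to a finite family of subspaces stable under taking
orthogonals. -/
theorem LinearMap.BilinForm.exists_isotropic_forall_inf_eq_bot (hB : B.Nondegenerate)
    (halt : B.IsAlt) (s : Finset (Submodule K H)) (hs : ∀ E ∈ s, B.orthogonal E ∈ s)
    (hne : s.Nonempty) (k : ℕ) (hk : ∀ E ∈ s, k + finrank K E ≤ finrank K H) :
    ∃ L : Submodule K H, finrank K L = k ∧ (∀ u ∈ L, ∀ v ∈ L, B u v = 0) ∧
      ∀ E ∈ s, L ⊓ E = ⊥ := by
  induction k with
  | zero => exact ⟨⊥, by simp, by simp, by simp⟩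
  | succ k ih =>
    obtain ⟨L, hLk, hiso, hLE⟩ := ih fun E hE => by have := hk E hE; omega
    obtain ⟨v, hv, hvE⟩ := LinearMap.BilinForm.exists_mem_orthogonal_forall_notMem_sup hB
      halt.isRefl s hs L (fun E hE => by have := hk E hE; omega) hLE
    have hvL : v ∉ L := fun h => by
      obtain ⟨E, hE⟩ := hne
      exact hvE E hE (Submodule.mem_sup_left h)
    have hLv : ∀ u ∈ L, B u v = 0 := fun u hu => hv u hu
    have hvL' : ∀ u ∈ L, B v u = 0 := fun u hu => halt.isRefl _ _ (hLv u hu)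
    refine ⟨L ⊔ K ∙ v, ?_, ?_, ?_⟩
    · have hv0 : v ≠ 0 := fun h => hvL (h ▸ L.zero_mem)
      have h1 := Submodule.finrank_sup_add_finrank_inf_eq L (K ∙ v)
      have h2 : L ⊓ K ∙ v = ⊥ := disjoint_iff.1 ((Submodule.disjoint_span_singleton' hv0).2 hvL)
      rw [h2, finrank_bot, finrank_span_singleton hv0] at h1
      omega
    · intro u hu w hw
      obtain ⟨a, ha, b, hb, rfl⟩ := Submodule.mem_sup.1 hu
      obtain ⟨c, rfl⟩ := Submodule.mem_span_singleton.1 hb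
      obtain ⟨a', ha', b', hb', rfl⟩ := Submodule.mem_sup.1 hw
      obtain ⟨c', rfl⟩ := Submodule.mem_span_singleton.1 hb'
      simp [hiso a ha a' ha', hLv a ha, hvL' a' ha', halt v]
    · intro E hE
      refine (Submodule.eq_bot_iff _).2 fun w hw => ?_
      obtain ⟨a, ha, b, hb, rfl⟩ := Submodule.mem_sup.1 hw.1
      obtain ⟨c, rfl⟩ := Submodule.mem_span_singleton.1 hb
      have hc : c = 0 := by
        by_contra hc
        refine hvE E hE ?_
        have : v = c⁻¹ • (-a) + c⁻¹ • (a + c • v) := by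
          rw [← smul_add, neg_add_cancel_left, inv_smul_smul₀ hc]
        rw [this]
        exact Submodule.add_mem_sup (L.smul_mem _ (L.neg_mem ha)) (E.smul_mem _ hw.2)
      have : a + c • v ∈ L ⊓ E := ⟨by simpa [hc] using ha, hw.2⟩
      rwa [hLE E hE, Submodule.mem_bot] at this

end Isotropic

section HomogeneousFunctions

variable (V : Type*) [AddCommGroup V] [Module ℝ V]

/-- The homogeneous polynomial functions of degree `n` on a real vector space. -/
noncomputable def homogeneousFunctions (n : ℕ) : Submodule ℝ (V → ℝ) :=
  LinearMap.range (LinearMap.ltoFun ℝ V ℝ ℝ) ^ n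

variable {V}

theorem homogeneousFunctions_fg [FiniteDimensional ℝ V] (n : ℕ) :
    (homogeneousFunctions V n).FG := by
  refine Submodule.FG.pow ?_ n
  rw [LinearMap.range_eq_map]
  exact Submodule.FG.map _ Module.Finite.fg_top

theorem prod_mem_homogeneousFunctions {ι : Type*} (s : Finset ι) (f : ι → V → ℝ) (n : ℕ)
    (hf : ∀ i ∈ s, f i ∈ homogeneousFunctions V n) :
    ∏ i ∈ s, f i ∈ homogeneousFunctions V (n * s.card) := by
  classical
  induction s using Finset.induction_on with
  | empty => simp [homogeneousFunctions]
  | insert a s ha ih =>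
    rw [Finset.prod_insert ha, Finset.card_insert_of_notMem ha, mul_add, mul_one, add_comm,
      homogeneousFunctions, pow_add]
    exact Submodule.mul_mem_mul (hf a (Finset.mem_insert_self a s))
      (ih fun i hi => hf i (Finset.mem_insert_of_mem hi))

theorem linearMap_mem_homogeneousFunctions (φ : V →ₗ[ℝ] ℝ) :
    (φ : V → ℝ) ∈ homogeneousFunctions V 1 := by
  rw [homogeneousFunctions, pow_one]
  exact ⟨φ, rfl⟩

theorem det_mem_homogeneousFunctions {ι : Type*} [Fintype ι] [DecidableEq ι]
    (φ : ι → ι → V →ₗ[ℝ] ℝ) :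
    (fun v => Matrix.det (Matrix.of fun i j => φ i j v)) ∈
      homogeneousFunctions V (Fintype.card ι) := by
  have : (fun v => Matrix.det (Matrix.of fun i j => φ i j v)) =
      ∑ σ : Equiv.Perm ι, ((Equiv.Perm.sign σ : ℤ) : ℝ) • ∏ i, (φ (σ i) i : V → ℝ) := by
    ext v
    simp [Matrix.det_apply']
  rw [this]
  refine Submodule.sum_mem _ fun σ _ => Submodule.smul_mem _ _ ?_
  simpa using prod_mem_homogeneousFunctions Finset.univ (fun i => (φ (σ i) i : V → ℝ)) 1
    fun i _ => linearMap_mem_homogeneousFunctions _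

theorem comp_mem_homogeneousFunctions {n : ℕ} {f : V → ℝ} (hf : f ∈ homogeneousFunctions V n)
    (x : V →ₗ[ℝ] V) : f ∘ x ∈ homogeneousFunctions V n := by
  let pull : (V → ℝ) →ₐ[ℝ] (V → ℝ) :=
    AlgHom.pi fun v => Pi.evalAlgHom ℝ (fun _ : V => ℝ) (x v)
  have hmap : (homogeneousFunctions V n).map pull.toLinearMap ≤ homogeneousFunctions V n := by
    rw [homogeneousFunctions, Submodule.map_pow]
    refine pow_le_pow_left' ?_ n
    rintro _ ⟨_, ⟨φ, rfl⟩, rfl⟩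
    exact ⟨φ ∘ₗ x, rfl⟩
  exact hmap ⟨f, hf, rfl⟩

theorem continuous_of_mem_homogeneousFunctions {V : Type*} [NormedAddCommGroup V]
    [NormedSpace ℝ V] [FiniteDimensional ℝ V] {n : ℕ} {f : V → ℝ}
    (hf : f ∈ homogeneousFunctions V n) : Continuous f := by
  refine Submodule.pow_induction_on_left (C := Continuous) _ (fun r => continuous_const)
    (fun _ _ hx hy => hx.add hy) ?_ hf
  rintro _ ⟨φ, rfl⟩ g hg
  exact φ.continuous_of_finiteDimensional.mul hg

end HomogeneousFunctions

section Transversality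

variable {H : Type*} [AddCommGroup H] [Module ℝ H] [FiniteDimensional ℝ H]

/-- Transversality to a fixed subspace is detected by a homogeneous polynomial in the frames. -/
theorem exists_homogeneousFunction_transverse (k : ℕ) (G : Submodule ℝ H)
    (hG : finrank ℝ G + k = finrank ℝ H) :
    ∃ p ∈ homogeneousFunctions (Fin k → H) k,
      ∀ L : Submodule ℝ H, finrank ℝ L = k →
        (L ⊓ G ≠ ⊥ → ∀ v : Fin k → H, (∀ i, v i ∈ L) → p v = 0) ∧
        (L ⊓ G = ⊥ → ∀ v : Fin k → H, LinearIndependent ℝ v → (∀ i, v i ∈ L) → p v ≠ 0) := by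
  have hquot : finrank ℝ (H ⧸ G) = finrank ℝ (Fin k → ℝ) := by
    have := G.finrank_quotient_add_finrank
    rw [finrank_fin_fun]
    omega
  let q : H →ₗ[ℝ] (Fin k → ℝ) := (LinearEquiv.ofFinrankEq _ _ hquot).toLinearMap ∘ₗ G.mkQ
  have hker : LinearMap.ker q = G := by simp [q]
  have hdet : ∀ v : Fin k → H, Matrix.det (Matrix.of fun i j => q (v i) j) ≠ 0 ↔
      LinearIndependent ℝ (fun i => q (v i)) := fun v => by
    rw [← isUnit_iff_ne_zero, ← Matrix.isUnit_iff_isUnit_det,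
      ← Matrix.linearIndependent_rows_iff_isUnit]
    rfl
  have hinj : ∀ L : Submodule ℝ H, L ⊓ G = ⊥ ↔ Function.Injective (q.domRestrict L) := by
    intro L
    rw [← LinearMap.ker_eq_bot, LinearMap.ker_domRestrict, hker, ← disjoint_iff,
      Submodule.disjoint_iff_comap_eq_bot]
  refine ⟨fun v => Matrix.det (Matrix.of fun i j => q (v i) j), ?_, fun L hL => ⟨?_, ?_⟩⟩
  · simpa using det_mem_homogeneousFunctions
      fun i j => LinearMap.proj j ∘ₗ q ∘ₗ LinearMap.proj (R := ℝ) (φ := fun _ : Fin k => H) i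
  · intro hLG v hv
    by_contra hne
    refine hLG ((hinj L).2 ?_)
    rw [LinearMap.injective_iff_surjective_of_finrank_eq_finrank (by simp [hL])]
    rw [← LinearMap.range_eq_top, eq_top_iff,
      ← ((hdet v).1 hne).span_eq_top_of_card_eq_finrank' (by simp), Submodule.span_le]
    rintro _ ⟨i, rfl⟩
    exact ⟨⟨v i, hv i⟩, rfl⟩
  · intro hLG v hli hv
    refine (hdet v).2 ?_
    have hli' : LinearIndependent ℝ (fun i => (⟨v i, hv i⟩ : L)) :=
      LinearIndependent.of_comp L.subtype hli
    exact hli'.map' (q.domRestrict L) (LinearMap.ker_eq_bot.2 ((hinj L).1 hLG))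

end Transversality

section Closedness

variable {H : Type*} [NormedAddCommGroup H] [NormedSpace ℝ H]

theorem isOpen_subDist_lt (L : Submodule ℝ H) {ε : ℝ} (hε : 0 < ε) :
    IsOpen {L' : Submodule ℝ H | subDist L L' < ε} :=
  TopologicalSpace.isOpen_generateFrom_of_mem ⟨L, ε, hε, rfl⟩

theorem subDist_self (L : Submodule ℝ H) : subDist L L = 0 :=
  Metric.hausdorffDist_self_zero

theorem exists_mem_dist_lt_of_subDist_lt {L L' : Submodule ℝ H} {ε R : ℝ} (hR : 0 < R)
    (h : subDist L L' < ε / R) {v : H} (hv : v ∈ L) (hvR : ‖v‖ ≤ R) :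
    ∃ v' ∈ L', dist v v' < ε := by
  have hmem : R⁻¹ • v ∈ (L : Set H) ∩ Metric.closedBall 0 1 := by
    refine ⟨L.smul_mem _ hv, ?_⟩
    rw [mem_closedBall_zero_iff, norm_smul, norm_inv, Real.norm_of_nonneg hR.le,
      inv_mul_le_iff₀ hR]
    simpa using hvR
  have hball : ∀ E : Submodule ℝ H, Bornology.IsBounded ((E : Set H) ∩ Metric.closedBall 0 1) :=
    fun E => Metric.isBounded_closedBall.subset Set.inter_subset_right
  have hne : ∀ E : Submodule ℝ H, ((E : Set H) ∩ Metric.closedBall 0 1).Nonempty :=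
    fun E => ⟨0, E.zero_mem, by simp⟩
  obtain ⟨w, hw, hdist⟩ := Metric.exists_dist_lt_of_hausdorffDist_lt hmem h
    (Metric.hausdorffEDist_ne_top_of_nonempty_of_bounded (hne L) (hne L') (hball L) (hball L'))
  refine ⟨R • w, L'.smul_mem _ hw.1, ?_⟩
  calc dist v (R • w) = dist (R • R⁻¹ • v) (R • w) := by rw [smul_inv_smul₀ hR.ne']
    _ = R * dist (R⁻¹ • v) w := by rw [dist_smul₀, Real.norm_of_nonneg hR.le]
    _ < ε := by rwa [lt_div_iff₀' hR] at hdist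

/-- Vanishing on all tuples of a subspace is a closed condition on the subspace. -/
theorem isClosed_setOf_forall_eq_zero {k : ℕ} (I : Set ((Fin k → H) → ℝ))
    (hI : ∀ f ∈ I, Continuous f) :
    IsClosed {L : Submodule ℝ H | ∀ f ∈ I, ∀ v : Fin k → H, (∀ i, v i ∈ L) → f v = 0} := by
  rw [← isOpen_compl_iff, isOpen_iff_forall_mem_open]
  intro L hL
  simp only [Set.mem_compl_iff, Set.mem_ofPred_eq, not_forall] at hL
  obtain ⟨f, hf, v, hv, hfv⟩ := hL
  obtain ⟨ε, hε, hball⟩ := Metric.isOpen_iff.1 (isOpen_ne_fun (hI f hf) continuous_const) v hfv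
  have hR : 0 < ‖v‖ + 1 := by positivity
  refine ⟨_, fun L' hL' hzero => ?_, isOpen_subDist_lt L (div_pos hε hR), ?_⟩
  · choose v' hv' hdist using fun i => exists_mem_dist_lt_of_subDist_lt hR hL' (hv i)
      ((norm_le_pi_norm v i).trans (by linarith))
    refine hball (a := v') ?_ (hzero f hf v' hv')
    rw [Metric.mem_ball, dist_comm, dist_pi_lt_iff hε]
    exact hdist
  · simpa [subDist_self] using div_pos hε hR

end Closedness

/-- If a monoid acting symplectically on `(H, ω)`, `dim H = 2g`, acts minimally on each
space of isotropic `k`-planes `Iso(k,H)`, `1 ≤ k ≤ g` (equivalently, on the space of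
Lagrangian flags), then it twists every isotropic subspace: given isotropic
`F ∈ Iso(k,H)` and finitely many `(2g−k)`-dimensional subspaces `F_i`, some `x` in the
monoid satisfies `(x·F) ∩ F_i = {0}` for all `i`. -/
theorem stmt13 {H : Type*} [NormedAddCommGroup H] [InnerProductSpace ℝ H]
    [FiniteDimensional ℝ H] (g : ℕ)
    (hdim : finrank ℝ H = 2 * g)
    (ω : H →ₗ[ℝ] H →ₗ[ℝ] ℝ)
    (halt : ∀ u v : H, ω u v = - ω v u)
    (hnd : ∀ u : H, (∀ v : H, ω u v = 0) → u = 0)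
    (M : Submonoid (H ≃ₗ[ℝ] H))
    (hM : ∀ x ∈ M, ∀ u v : H, ω (x u) (x v) = ω u v)
    (hmin : ∀ k : ℕ, 1 ≤ k → k ≤ g →
      ∀ C : Set (Submodule ℝ H), C ⊆ IsoGrass ω k →
        (∃ D : Set (Submodule ℝ H), IsClosed D ∧ C = D ∩ IsoGrass ω k) →
        C.Nonempty →
        (∀ x ∈ M, (fun L : Submodule ℝ H => Submodule.map x.toLinearMap L) '' C = C) →
        C = IsoGrass ω k) :
    ∀ k : ℕ, 1 ≤ k → k ≤ g → ∀ F ∈ IsoGrass ω k,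
      ∀ 𝒢 : Finset (Submodule ℝ H), (∀ G ∈ 𝒢, finrank ℝ G = 2 * g - k) →
        ∃ x ∈ M, ∀ G ∈ 𝒢, Submodule.map x.toLinearMap F ⊓ G = ⊥ := by
  intro k hk1 hkg F hF 𝒢 h𝒢
  classical
  rcases 𝒢.eq_empty_or_nonempty with rfl | hne
  · exact ⟨1, M.one_mem, by simp⟩
  by_contra! hcon
  choose! p hpW hp using fun G (hG : G ∈ 𝒢) => exists_homogeneousFunction_transverse k G
    (by rw [h𝒢 G hG, hdim]; omega)
  let W := homogeneousFunctions (Fin k → H) (k * 𝒢.card)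
  have hPW : ∏ G ∈ 𝒢, p G ∈ W := prod_mem_homogeneousFunctions 𝒢 p k hpW
  let I : Submodule ℝ ((Fin k → H) → ℝ) :=
    { carrier := {f | f ∈ W ∧ ∀ x ∈ M, ∀ v : Fin k → H,
        (∀ i, v i ∈ F.map x.toLinearMap) → f v = 0}
      add_mem' := fun hf hf' => ⟨W.add_mem hf.1 hf'.1, fun x hx v hv => by
        simp [hf.2 x hx v hv, hf'.2 x hx v hv]⟩
      zero_mem' := ⟨W.zero_mem, fun _ _ _ _ => rfl⟩
      smul_mem' := fun c f hf => ⟨W.smul_mem c hf.1, fun x hx v hv => by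
        simp [hf.2 x hx v hv]⟩ }
  have hIW : I ≤ W := fun f hf => hf.1
  have hWfin : FiniteDimensional ℝ W :=
    Module.Finite.of_fg (homogeneousFunctions_fg _)
  have hIfin : FiniteDimensional ℝ I := Submodule.finiteDimensional_of_le hIW
  have hPI : ∏ G ∈ 𝒢, p G ∈ I := by
    refine ⟨hPW, fun x hx v hv => ?_⟩
    obtain ⟨G, hG, hxG⟩ := hcon x hx
    rw [Finset.prod_apply]
    exact Finset.prod_eq_zero hG
      ((hp G hG _ ((LinearEquiv.finrank_map_eq x F).trans hF.1)).1 hxG v hv)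
  have hIx : ∀ x ∈ M, ∀ f ∈ I, f ∘ (fun v i => x (v i)) ∈ I := by
    intro x hx f hf
    refine ⟨comp_mem_homogeneousFunctions hf.1 (LinearMap.compLeft x.toLinearMap (Fin k)),
      fun y hy v hv => hf.2 (x * y) (M.mul_mem hx hy) _ fun i => ?_⟩
    obtain ⟨u, hu, huv⟩ := hv i
    exact ⟨u, hu, congrArg x huv⟩
  have hIsurj : ∀ x ∈ M, ∀ f ∈ I, ∃ h ∈ I, h ∘ (fun v i => x (v i)) = f := by
    intro x hx
    let T : I →ₗ[ℝ] I :=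
      ((LinearMap.funLeft ℝ ℝ fun (v : Fin k → H) i => x (v i)).restrict (hIx x hx))
    have hT : Function.Injective T := by
      intro f f' hff'
      refine Subtype.ext (funext fun v => ?_)
      have := congrFun (congrArg Subtype.val hff') fun i => x.symm (v i)
      change f.1 (fun i => x (x.symm (v i))) = f'.1 (fun i => x (x.symm (v i))) at this
      simpa using this
    intro f hf
    obtain ⟨h, hh⟩ := LinearMap.surjective_of_injective hT ⟨f, hf⟩
    exact ⟨h, h.2, congrArg Subtype.val hh⟩
  let D : Set (Submodule ℝ H) :=
    {L | ∀ f ∈ (I : Set ((Fin k → H) → ℝ)), ∀ v : Fin k → H, (∀ i, v i ∈ L) → f v = 0}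
  have hD : IsClosed D := isClosed_setOf_forall_eq_zero _
    fun f hf => continuous_of_mem_homogeneousFunctions (hIW hf)
  have hC := hmin k hk1 hkg (D ∩ IsoGrass ω k) Set.inter_subset_right ⟨D, hD, rfl⟩
    ⟨F, fun f hf v hv => hf.2 1 M.one_mem v fun i => ⟨v i, hv i, rfl⟩, hF⟩ (by
      intro x hx
      ext L
      constructor
      · rintro ⟨L, ⟨hLD, hLk, hLiso⟩, rfl⟩
        refine ⟨fun f hf v hv => ?_, (LinearEquiv.finrank_map_eq x L).trans hLk, ?_⟩
        · choose u hu huv using hv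
          have := hLD _ (hIx x hx f hf) u hu
          rwa [← show (fun i => x (u i)) = v from funext huv]
        · rintro _ ⟨u, hu, rfl⟩ _ ⟨v, hv, rfl⟩
          exact (hM x hx u v).trans (hLiso u hu v hv)
      · rintro ⟨hLD, hLk, hLiso⟩
        have hmem : ∀ u ∈ L.map x.symm.toLinearMap, x u ∈ L := by
          rintro _ ⟨w, hw, rfl⟩
          simpa using hw
        refine ⟨L.map x.symm.toLinearMap, ⟨fun f hf u hu => ?_,
          (LinearEquiv.finrank_map_eq x.symm L).trans hLk, fun u hu v hv => ?_⟩, ?_⟩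
        · obtain ⟨h, hhI, rfl⟩ := hIsurj x hx f hf
          exact hLD h hhI _ fun i => hmem _ (hu i)
        · rw [← hM x hx]
          exact hLiso _ (hmem u hu) _ (hmem v hv)
        · ext w
          simp)
  have hnondeg : LinearMap.BilinForm.Nondegenerate ω :=
    ⟨hnd, fun u hu => hnd u fun v => by rw [halt, hu, neg_zero]⟩
  have halt' : LinearMap.BilinForm.IsAlt ω := fun u => by
    have := halt u u
    linarith
  obtain ⟨L, hLk, hLiso, hLG⟩ := LinearMap.BilinForm.exists_isotropic_forall_inf_eq_bot hnondeg
    halt' (𝒢 ∪ 𝒢.image (LinearMap.BilinForm.orthogonal ω))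
    (fun E hE => by
      rcases Finset.mem_union.1 hE with hE | hE
      · exact Finset.mem_union_right _ (Finset.mem_image_of_mem _ hE)
      · obtain ⟨G, hG, rfl⟩ := Finset.mem_image.1 hE
        rw [LinearMap.BilinForm.orthogonal_orthogonal hnondeg halt'.isRefl]
        exact Finset.mem_union_left _ hG)
    (hne.mono Finset.subset_union_left) k
    (fun E hE => by
      rcases Finset.mem_union.1 hE with hE | hE
      · rw [h𝒢 E hE, hdim]
        omega
      · obtain ⟨G, hG, rfl⟩ := Finset.mem_image.1 hE
        rw [LinearMap.BilinForm.finrank_orthogonal hnondeg, h𝒢 G hG, hdim]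
        omega)
  have hLD : L ∈ D ∩ IsoGrass ω k := hC.ge ⟨hLk, hLiso⟩
  let b := finBasisOfFinrankEq ℝ L hLk
  have hzero := hLD.1 _ hPI (fun i => b i) fun i => (b i).2
  rw [Finset.prod_apply] at hzero
  obtain ⟨G, hG, hpG⟩ := Finset.prod_eq_zero_iff.1 hzero
  exact (hp G hG L hLk).2 (hLG G (Finset.mem_union_left _ hG)) _
    (b.linearIndependent.map' L.subtype L.ker_subtype) (fun i => (b i).2) hpG
end

section
/- Let ℬ be a monoid acting symplectically on (H, ω) with dim H = 2g, acting via an inner product adapted to ω. If for every C > 0 there exists x ∈ ℬ such that x has an eigenvalue 1 of geometric multiplicity 1 and the positive Lyapunov exponents satisfy θ_{g−1}(x) > 0 and θ_k(x) > C · θ_{k+1}(x) for all 1 ≤ k ≤ g − 2, then ℬ is strongly pinching: for every C > 0 there exists y ∈ ℬ with log σ_g(y) > C and log σ_i(y) > C · log σ_{i+1}(y) for all 1 ≤ i ≤ g − 1. -/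
open Module Filter RealInnerProductSpace

/-- The `k`-th singular value of `x` (1-indexed, decreasing). -/
noncomputable def sVal {H : Type*} [NormedAddCommGroup H] [InnerProductSpace ℝ H]
    (x : H →ₗ[ℝ] H) (k : ℕ) : ℝ :=
  sSup {r : ℝ | 0 ≤ r ∧ ∃ F : Submodule ℝ H, finrank ℝ F = k ∧ ∀ v ∈ F, r * ‖v‖ ≤ ‖x v‖}

/-- The `i`-th Lyapunov exponent of a single isomorphism:
`θ_i(x) = lim (1/n) log σ_i(xⁿ)` (the limit exists; we use `limsup`). -/
noncomputable def lyap {H : Type*} [NormedAddCommGroup H] [InnerProductSpace ℝ H]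
    (x : H ≃ₗ[ℝ] H) (i : ℕ) : ℝ :=
  Filter.limsup (fun n : ℕ => Real.log (sVal (x ^ n).toLinearMap i) / n) Filter.atTop

section Polynomials

open Polynomial

/-- The complex roots of an irreducible real polynomial all have the same modulus. -/
theorem norm_eq_of_irreducible_of_aeval_eq_zero {f : ℝ[X]} (hf : Irreducible f) {z w : ℂ}
    (hz : aeval z f = 0) (hw : aeval w f = 0) : ‖z‖ = ‖w‖ := by
  have h : IsConjRoot ℝ z w := by
    rw [isConjRoot_def, ← minpoly.eq_of_irreducible hf hz, ← minpoly.eq_of_irreducible hf hw]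
  have : Normal ℝ ℂ := normal_iff.2 fun z =>
    ⟨Algebra.IsIntegral.isIntegral z, IsAlgClosed.splits _⟩
  obtain ⟨σ, rfl⟩ := isConjRoot_iff_exists_algEquiv.mp h
  rcases Complex.real_algHom_eq_id_or_conj σ.toAlgHom with hσ | hσ
  · rw [show σ w = w from DFunLike.congr_fun hσ w]
  · rw [show σ w = _ from DFunLike.congr_fun hσ w]
    simp

/-- A nonzero real polynomial splits into a factor with complex roots of modulus at most `ρ`
and a factor with complex roots of modulus larger than `ρ`. -/
theorem exists_mul_eq_of_norm_root (ρ : ℝ) (p : ℝ[X]) (hp : p ≠ 0) :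
    ∃ q r : ℝ[X], p = q * r ∧ (∀ z : ℂ, aeval z q = 0 → ‖z‖ ≤ ρ) ∧
      ∀ z : ℂ, aeval z r = 0 → ρ < ‖z‖ := by
  induction p using UniqueFactorizationMonoid.induction_on_prime with
  | h₁ => exact absurd rfl hp
  | h₂ a ha =>
    refine ⟨a, 1, by simp, fun z hz => ?_, by simp⟩
    exact absurd hz (ha.map (aeval z)).ne_zero
  | h₃ a f ha hf ih =>
    obtain ⟨q, r, rfl, hq, hr⟩ := ih ha
    by_cases h : ∃ z : ℂ, aeval z f = 0 ∧ ‖z‖ ≤ ρ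
    · obtain ⟨z, hz, hzρ⟩ := h
      refine ⟨f * q, r, by ring, fun w hw => ?_, hr⟩
      rw [map_mul, mul_eq_zero] at hw
      rcases hw with hw | hw
      · rwa [← norm_eq_of_irreducible_of_aeval_eq_zero hf.irreducible hz hw]
      · exact hq w hw
    · push Not at h
      refine ⟨q, f * r, by ring, hq, fun w hw => ?_⟩
      rw [map_mul, mul_eq_zero] at hw
      exact hw.elim (h w) (hr w)

end Polynomials

section Recurrences

open Polynomial

/-- The shift operator on bi-infinite complex sequences. -/
noncomputable def seqShift : Module.End ℂ (ℤ → ℂ) := LinearMap.funLeft ℂ ℂ (· + 1)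

theorem seqShift_apply (u : ℤ → ℂ) (n : ℤ) : seqShift u n = u (n + 1) := rfl

theorem exists_le_mul_pow_of_le_add {a : ℕ → ℝ} {s ρ K : ℝ} (hs : 0 ≤ s) (hsρ : s < ρ)
    (h : ∀ n, a (n + 1) ≤ s * a n + K * ρ ^ n) : ∃ K', ∀ n, a n ≤ K' * ρ ^ n := by
  refine ⟨max (a 0) (K / (ρ - s)), fun n => ?_⟩
  have hK : K ≤ max (a 0) (K / (ρ - s)) * (ρ - s) := by
    rw [← div_le_iff₀ (sub_pos.2 hsρ)]
    exact le_max_right _ _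
  have hρ : 0 < ρ := hs.trans_lt hsρ
  induction n with
  | zero => simp
  | succ n ih =>
    calc a (n + 1) ≤ s * a n + K * ρ ^ n := h n
      _ ≤ s * (max (a 0) (K / (ρ - s)) * ρ ^ n) +
          max (a 0) (K / (ρ - s)) * (ρ - s) * ρ ^ n := by gcongr
      _ = _ := by ring

theorem exists_norm_le_mul_pow_of_aeval_seqShift_prod {ρ : ℝ} (s : Multiset ℂ)
    (hs : ∀ z ∈ s, ‖z‖ < ρ) (u : ℤ → ℂ)
    (hu : aeval seqShift (s.map fun z => X - C z).prod u = 0) :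
    ∃ K, ∀ n : ℕ, ‖u n‖ ≤ K * ρ ^ n := by
  induction s using Multiset.induction_on generalizing u with
  | empty =>
    have : u = 0 := by simpa using hu
    exact ⟨0, by simp [this]⟩
  | cons z s ih =>
    rw [Multiset.map_cons, Multiset.prod_cons, mul_comm, map_mul] at hu
    obtain ⟨K, hK⟩ := ih (fun w hw => hs w (Multiset.mem_cons_of_mem hw)) _ hu
    refine exists_le_mul_pow_of_le_add (K := K) (norm_nonneg z)
      (hs z (Multiset.mem_cons_self z s)) fun n => ?_
    have h := hK n
    simp only [map_sub, aeval_X, aeval_C, LinearMap.sub_apply, Module.algebraMap_end_apply,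
      Pi.sub_apply, Pi.smul_apply, seqShift_apply, smul_eq_mul] at h
    calc ‖u ((n + 1 : ℕ) : ℤ)‖ = ‖z * u n + (u (n + 1) - z * u n)‖ := by push_cast; ring_nf
      _ ≤ ‖z‖ * ‖u n‖ + ‖u (n + 1) - z * u n‖ := by
        rw [← norm_mul]; exact norm_add_le _ _
      _ ≤ _ := by gcongr

theorem exists_norm_neg_le_mul_pow_of_aeval_seqShift_prod {ρ : ℝ} (hρ : 0 < ρ) (s : Multiset ℂ)
    (hs : ∀ z ∈ s, ρ < ‖z‖) (u : ℤ → ℂ)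
    (hu : aeval seqShift (s.map fun z => X - C z).prod u = 0) :
    ∃ K, ∀ n : ℕ, ‖u (-n)‖ ≤ K * ρ⁻¹ ^ n := by
  induction s using Multiset.induction_on generalizing u with
  | empty =>
    have : u = 0 := by simpa using hu
    exact ⟨0, by simp [this]⟩
  | cons z s ih =>
    rw [Multiset.map_cons, Multiset.prod_cons, mul_comm, map_mul] at hu
    obtain ⟨K, hK⟩ := ih (fun w hw => hs w (Multiset.mem_cons_of_mem hw)) _ hu
    have hz := hs z (Multiset.mem_cons_self z s)
    have hz0 : 0 < ‖z‖ := hρ.trans hz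
    refine exists_le_mul_pow_of_le_add (K := ‖z‖⁻¹ * (K * ρ⁻¹)) (inv_nonneg.2 hz0.le)
      (inv_strictAnti₀ hρ hz) fun n => ?_
    have h := hK (n + 1)
    simp only [map_sub, aeval_X, aeval_C, LinearMap.sub_apply, Module.algebraMap_end_apply,
      Pi.sub_apply, Pi.smul_apply, seqShift_apply, smul_eq_mul] at h
    have e : -((n + 1 : ℕ) : ℤ) + 1 = -n := by push_cast; ring
    rw [e] at h
    have hz' : z ≠ 0 := norm_pos_iff.1 hz0
    calc ‖u (-((n + 1 : ℕ) : ℤ))‖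
        = ‖z⁻¹ * (u (-n) - (u (-n) - z * u (-((n + 1 : ℕ) : ℤ))))‖ := by
          congr 1; field_simp; ring
      _ ≤ ‖z‖⁻¹ * (‖u (-n)‖ + ‖u (-n) - z * u (-((n + 1 : ℕ) : ℤ))‖) := by
        rw [norm_mul, norm_inv]; gcongr; exact norm_sub_le _ _
      _ ≤ ‖z‖⁻¹ * (‖u (-n)‖ + K * ρ⁻¹ ^ (n + 1)) := by gcongr
      _ = _ := by ring

/-- A sequence annihilated by `q` evaluated at the shift is annihilated by the product of the
linear factors of `q`. -/
theorem aeval_seqShift_prod_roots_eq_zero {q : ℂ[X]} (hq : q ≠ 0) {u : ℤ → ℂ}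
    (hu : aeval seqShift q u = 0) :
    aeval seqShift (q.roots.map fun z => X - C z).prod u = 0 := by
  have h := (IsAlgClosed.splits q).eq_prod_roots
  rw [h, map_mul, aeval_C, Module.End.mul_apply, Module.algebraMap_end_apply] at hu
  exact (smul_eq_zero.1 hu).resolve_left (leadingCoeff_ne_zero.2 hq)

end Recurrences

section Dynamics

open Polynomial

variable {H : Type*} [NormedAddCommGroup H] [InnerProductSpace ℝ H]

theorem toLinearMap_pow (x : H ≃ₗ[ℝ] H) (n : ℕ) :
    (x ^ n).toLinearMap = (x.toLinearMap : Module.End ℝ H) ^ n :=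
  map_pow (LinearEquiv.automorphismGroup.toLinearMapMonoidHom (R := ℝ) (M := H)) x n

theorem aeval_seqShift_orbit (x : H ≃ₗ[ℝ] H) (φ : H →ₗ[ℝ] ℝ) (v : H) (q : ℝ[X]) (n : ℤ) :
    aeval seqShift (q.map (algebraMap ℝ ℂ)) (fun m : ℤ => (φ ((x ^ m) v) : ℂ)) n =
      φ ((x ^ n) (aeval (x.toLinearMap : Module.End ℝ H) q v)) := by
  induction q using Polynomial.induction_on' generalizing n with
  | add p q hp hq => simp only [Polynomial.map_add, map_add, LinearMap.add_apply, Pi.add_apply, hp, hq,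
      Complex.ofReal_add]
  | monomial k a =>
    have h : ∀ (k : ℕ) (u : ℤ → ℂ) (n : ℤ), (seqShift ^ k) u n = u (n + k) := by
      intro k
      induction k with
      | zero => simp
      | succ k ih =>
        intro u n
        rw [pow_succ, Module.End.mul_apply, ih, seqShift_apply]
        push_cast; ring_nf
    rw [map_monomial, aeval_monomial, aeval_monomial]
    simp only [Module.End.mul_apply, Module.algebraMap_end_apply, Pi.smul_apply, h, map_smul,
      ← toLinearMap_pow, LinearEquiv.coe_coe]
    rw [← LinearEquiv.mul_apply, ← zpow_natCast x k, ← zpow_add]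
    simp

variable [FiniteDimensional ℝ H]

/-- A pointwise bound on all matrix coefficients gives a uniform bound on a subspace. -/
theorem exists_norm_le_mul_of_forall_coeff {ι : Type*} (A : ι → H →ₗ[ℝ] H) (N : Submodule ℝ H)
    (b : ι → ℝ) (hb : ∀ i, 0 ≤ b i)
    (h : ∀ (φ : H →ₗ[ℝ] ℝ), ∀ v ∈ N, ∃ K, ∀ i, |φ (A i v)| ≤ K * b i) :
    ∃ K, 0 < K ∧ ∀ i, ∀ v ∈ N, ‖A i v‖ ≤ K * b i * ‖v‖ := by
  let e := stdOrthonormalBasis ℝ H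
  let f := stdOrthonormalBasis ℝ N
  choose! K hK using h
  let L := ∑ j, ∑ k, |K (innerₛₗ ℝ (e k)) (f j : H)|
  refine ⟨L + 1, by positivity, fun i v hv => ?_⟩
  have h1 : ∀ j, ‖A i (f j : H)‖ ≤ (∑ k, |K (innerₛₗ ℝ (e k)) (f j : H)|) * b i := by
    intro j
    rw [← e.sum_repr (A i (f j : H)), Finset.sum_mul]
    refine (norm_sum_le _ _).trans (Finset.sum_le_sum fun k _ => ?_)
    rw [norm_smul, e.orthonormal.1 k, mul_one, e.repr_apply_apply, Real.norm_eq_abs]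
    refine (hK (innerₛₗ ℝ (e k)) _ (f j).2 i).trans ?_
    have := hb i
    gcongr
    exact le_abs_self _
  have h2 : A i v = ∑ j, f.repr ⟨v, hv⟩ j • A i (f j : H) := by
    have := congrArg (fun w : N => A i (w : H)) (f.sum_repr ⟨v, hv⟩)
    simpa using this.symm
  have h3 : ∀ j, ‖f.repr ⟨v, hv⟩ j‖ ≤ ‖v‖ := by
    intro j
    rw [f.repr_apply_apply]
    refine (norm_inner_le_norm _ _).trans ?_
    rw [f.orthonormal.1 j, one_mul]
    rfl
  calc ‖A i v‖ ≤ ∑ j, ‖f.repr ⟨v, hv⟩ j‖ * ‖A i (f j : H)‖ := by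
        rw [h2]
        refine (norm_sum_le _ _).trans (Finset.sum_le_sum fun k _ => ?_)
        rw [norm_smul]
    _ ≤ ∑ j, ‖v‖ * ((∑ k, |K (innerₛₗ ℝ (e k)) (f j : H)|) * b i) := by
        gcongr with j _
        · exact h3 j
        · exact h1 j
    _ = L * b i * ‖v‖ := by
        rw [← Finset.mul_sum, ← Finset.sum_mul, mul_comm]
    _ ≤ _ := by
        have := hb i
        gcongr
        linarith

theorem exists_norm_pow_le_of_ker_aeval (x : H ≃ₗ[ℝ] H) {q : ℝ[X]} (hq0 : q ≠ 0) {ρ : ℝ}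
    (hρ : 0 < ρ) (hq : ∀ z : ℂ, aeval z q = 0 → ‖z‖ < ρ) :
    ∃ K, 0 < K ∧ ∀ n : ℕ, ∀ v ∈ LinearMap.ker (aeval (x.toLinearMap : Module.End ℝ H) q),
      ‖(x ^ n) v‖ ≤ K * ρ ^ n * ‖v‖ := by
  refine exists_norm_le_mul_of_forall_coeff (fun n : ℕ => (x ^ n).toLinearMap) _
    (fun n => ρ ^ n) (fun n => by positivity) fun φ v hv => ?_
  have hq0' : q.map (algebraMap ℝ ℂ) ≠ 0 := (Polynomial.map_ne_zero_iff
    (algebraMap ℝ ℂ).injective).2 hq0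
  have hroots : ∀ z ∈ (q.map (algebraMap ℝ ℂ)).roots, aeval z q = 0 := fun z hz => by
    rwa [mem_roots hq0', IsRoot.def, eval_map_algebraMap] at hz
  have hker : aeval seqShift (q.map (algebraMap ℝ ℂ)) (fun m : ℤ => (φ ((x ^ m) v) : ℂ)) = 0 := by
    ext n
    rw [aeval_seqShift_orbit, LinearMap.mem_ker.1 hv]
    simp
  obtain ⟨K, hK⟩ := exists_norm_le_mul_pow_of_aeval_seqShift_prod (ρ := ρ)
    _ (fun z hz => hq z (hroots z hz)) _ (aeval_seqShift_prod_roots_eq_zero hq0' hker)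
  refine ⟨K, fun n => ?_⟩
  simpa using hK n

theorem exists_norm_inv_pow_le_of_ker_aeval (x : H ≃ₗ[ℝ] H) {q : ℝ[X]} (hq0 : q ≠ 0) {ρ : ℝ}
    (hρ : 0 < ρ) (hq : ∀ z : ℂ, aeval z q = 0 → ρ < ‖z‖) :
    ∃ K, 0 < K ∧ ∀ n : ℕ, ∀ v ∈ LinearMap.ker (aeval (x.toLinearMap : Module.End ℝ H) q),
      ‖(x⁻¹ ^ n) v‖ ≤ K * ρ⁻¹ ^ n * ‖v‖ := by
  refine exists_norm_le_mul_of_forall_coeff (fun n : ℕ => (x⁻¹ ^ n).toLinearMap) _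
    (fun n => ρ⁻¹ ^ n) (fun n => by positivity) fun φ v hv => ?_
  have hq0' : q.map (algebraMap ℝ ℂ) ≠ 0 := (Polynomial.map_ne_zero_iff
    (algebraMap ℝ ℂ).injective).2 hq0
  have hroots : ∀ z ∈ (q.map (algebraMap ℝ ℂ)).roots, aeval z q = 0 := fun z hz => by
    rwa [mem_roots hq0', IsRoot.def, eval_map_algebraMap] at hz
  have hker : aeval seqShift (q.map (algebraMap ℝ ℂ)) (fun m : ℤ => (φ ((x ^ m) v) : ℂ)) = 0 := by
    ext n
    rw [aeval_seqShift_orbit, LinearMap.mem_ker.1 hv]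
    simp
  obtain ⟨K, hK⟩ := exists_norm_neg_le_mul_pow_of_aeval_seqShift_prod hρ
    _ (fun z hz => hq z (hroots z hz)) _ (aeval_seqShift_prod_roots_eq_zero hq0' hker)
  refine ⟨K, fun n => ?_⟩
  have := hK n
  rw [zpow_neg, zpow_natCast, ← inv_pow] at this
  simpa using this

/-- Spectral splitting at modulus `ρ`: the space is the sum of an invariant subspace `E` expanded
at rate at least `ρ` and a subspace `N` whose growth rate is at most `ρ`. -/
theorem exists_spectral_splitting (x : H ≃ₗ[ℝ] H) {ρ : ℝ} (hρ : 0 < ρ) :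
    ∃ E N : Submodule ℝ H, finrank ℝ E + finrank ℝ N = finrank ℝ H ∧
      (∀ v ∈ E, ∀ n : ℕ, (x ^ n) v ∈ E) ∧
      (∃ K, 0 < K ∧ ∀ n : ℕ, ∀ v ∈ E, ‖(x⁻¹ ^ n) v‖ ≤ K * ρ⁻¹ ^ n * ‖v‖) ∧
      ∀ ρ', ρ < ρ' → ∃ K, 0 < K ∧ ∀ n : ℕ, ∀ v ∈ N, ‖(x ^ n) v‖ ≤ K * ρ' ^ n * ‖v‖ := by
  let T : Module.End ℝ H := x.toLinearMap
  have hT0 : T.charpoly ≠ 0 := T.charpoly_monic.ne_zero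
  obtain ⟨q, r, hqr, hq, hr⟩ := exists_mul_eq_of_norm_root ρ T.charpoly hT0
  have hq0 : q ≠ 0 := fun h => hT0 (by rw [hqr, h, zero_mul])
  have hr0 : r ≠ 0 := fun h => hT0 (by rw [hqr, h, mul_zero])
  have hcop : IsCoprime r q := by
    refine (isCoprime_iff_aeval_ne_zero_of_isAlgClosed ℝ ℂ r q).2 fun z => ?_
    by_contra! h
    exact absurd (hq z h.2) (not_le.2 (hr z h.1))
  refine ⟨LinearMap.ker (aeval T r), LinearMap.ker (aeval T q), ?_, fun v hv n => ?_,
    exists_norm_inv_pow_le_of_ker_aeval x hr0 hρ hr, fun ρ' hρ' =>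
    exists_norm_pow_le_of_ker_aeval x hq0 (hρ.trans hρ') fun z hz => (hq z hz).trans_lt hρ'⟩
  · refine Submodule.finrank_add_eq_of_isCompl ⟨disjoint_ker_aeval_of_isCoprime T hcop, ?_⟩
    rw [codisjoint_iff, sup_ker_aeval_eq_ker_aeval_mul_of_coprime T hcop, mul_comm, ← hqr,
      LinearMap.aeval_self_charpoly, LinearMap.ker_zero]
  · have h1 : (x ^ n) v = aeval T (X ^ n : ℝ[X]) v := by
      rw [map_pow, aeval_X, ← toLinearMap_pow, LinearEquiv.coe_coe]
    rw [LinearMap.mem_ker, h1, ← Module.End.mul_apply, ← map_mul, mul_comm, map_mul,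
      Module.End.mul_apply, LinearMap.mem_ker.1 hv, map_zero]

end Dynamics

section SingularValues

variable {H : Type*} [NormedAddCommGroup H] [InnerProductSpace ℝ H]

theorem norm_le_of_inv_pow_contracts {x : H ≃ₗ[ℝ] H} {E : Submodule ℝ H} {K ρ : ℝ}
    (hinv : ∀ v ∈ E, ∀ n : ℕ, (x ^ n) v ∈ E) (hK : 0 < K) (hρ : 0 < ρ)
    (h : ∀ n : ℕ, ∀ v ∈ E, ‖(x⁻¹ ^ n) v‖ ≤ K * ρ⁻¹ ^ n * ‖v‖) (n : ℕ) {v : H} (hv : v ∈ E) :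
    K⁻¹ * ρ ^ n * ‖v‖ ≤ ‖(x ^ n) v‖ := by
  have h1 := h n _ (hinv v hv n)
  rw [← LinearEquiv.mul_apply, inv_pow, inv_mul_cancel, LinearEquiv.coe_one, id] at h1
  rw [inv_pow] at h1
  have hρn : 0 < ρ ^ n := by positivity
  calc K⁻¹ * ρ ^ n * ‖v‖ ≤ K⁻¹ * ρ ^ n * (K * (ρ ^ n)⁻¹ * ‖(x ^ n) v‖) := by gcongr
    _ = _ := by field_simp

variable [FiniteDimensional ℝ H]

theorem le_sVal {x : H →ₗ[ℝ] H} {k : ℕ} (hk : 1 ≤ k) {r : ℝ} (hr : 0 ≤ r) {F : Submodule ℝ H}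
    (hF : k ≤ finrank ℝ F) (h : ∀ v ∈ F, r * ‖v‖ ≤ ‖x v‖) : r ≤ sVal x k := by
  obtain ⟨F', hF'F, hF'⟩ : ∃ F' : Submodule ℝ H, F' ≤ F ∧ finrank ℝ F' = k := by
    obtain ⟨f, hf⟩ := exists_linearIndependent_of_le_finrank hF
    refine ⟨Submodule.span ℝ (Set.range fun j => (f j : H)), ?_, ?_⟩
    · rw [Submodule.span_le]
      rintro _ ⟨j, rfl⟩
      exact (f j).2
    · have hf' : LinearIndependent ℝ fun j => (f j : H) :=
        hf.map' F.subtype F.ker_subtype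
      rw [finrank_span_eq_card hf', Fintype.card_fin]
  refine le_csSup ⟨‖x.toContinuousLinearMap‖, ?_⟩ ⟨hr, F', hF', fun v hv => h v (hF'F hv)⟩
  rintro s ⟨-, G, hG, hs⟩
  have : 0 < finrank ℝ G := by omega
  obtain ⟨v, hv⟩ := Module.finrank_pos_iff_exists_ne_zero.1 this
  have hv' : 0 < ‖(v : H)‖ := by simpa using hv
  exact le_of_mul_le_mul_right ((hs v v.2).trans (x.toContinuousLinearMap.le_opNorm v)) hv'

theorem sVal_le {x : H →ₗ[ℝ] H} {k : ℕ} {R : ℝ} (hR : 0 ≤ R) {G : Submodule ℝ H}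
    (hG : finrank ℝ H < finrank ℝ G + k) (h : ∀ v ∈ G, ‖x v‖ ≤ R * ‖v‖) : sVal x k ≤ R := by
  refine Real.sSup_le ?_ hR
  rintro s ⟨-, F, hF, hs⟩
  have hGF : ¬ Disjoint G F := fun hd => by
    have := Submodule.finrank_add_finrank_le_of_disjoint hd
    omega
  rw [disjoint_iff, Submodule.eq_bot_iff] at hGF
  push Not at hGF
  obtain ⟨v, hv, hv0⟩ := hGF
  exact le_of_mul_le_mul_right ((hs v hv.2).trans (h v hv.1)) (norm_pos_iff.2 hv0)

/-- Iterates of an isomorphism are bounded above and below exponentially. -/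
theorem exists_pow_mul_norm_le (x : H ≃ₗ[ℝ] H) : ∃ c K : ℝ, 0 < c ∧ 0 < K ∧
    ∀ (n : ℕ) (v : H), c ^ n * ‖v‖ ≤ ‖(x ^ n) v‖ ∧ ‖(x ^ n) v‖ ≤ K ^ n * ‖v‖ := by
  obtain ⟨L, hL, hxL⟩ := x.toLinearMap.exists_antilipschitzWith x.ker
  have hlow : ∀ v, (L : ℝ)⁻¹ * ‖v‖ ≤ ‖x v‖ := fun v => by
    have hL' : (0 : ℝ) < L := hL
    rw [inv_mul_le_iff₀ hL']
    simpa using hxL.le_mul_dist v 0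
  set T := x.toLinearMap.toContinuousLinearMap
  have hup : ∀ v, ‖x v‖ ≤ (‖T‖ + 1) * ‖v‖ := fun v => by
    have := T.le_opNorm v
    have e : T v = x v := rfl
    rw [e] at this
    nlinarith [norm_nonneg v]
  refine ⟨(L : ℝ)⁻¹, ‖T‖ + 1, by positivity, by positivity, fun n v => ?_⟩
  induction n generalizing v with
  | zero => simp
  | succ n ih =>
    rw [pow_succ x, LinearEquiv.mul_apply]
    refine ⟨le_trans ?_ (ih (x v)).1, (ih (x v)).2.trans ?_⟩
    · rw [pow_succ, mul_assoc]
      gcongr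
      exact hlow v
    · rw [pow_succ, mul_assoc]
      gcongr
      exact hup v

theorem exists_pow_le_sVal_pow (x : H ≃ₗ[ℝ] H) : ∃ c K : ℝ, 0 < c ∧ 0 < K ∧
    ∀ i : ℕ, 1 ≤ i → i ≤ finrank ℝ H → ∀ n : ℕ,
      c ^ n ≤ sVal (x ^ n).toLinearMap i ∧ sVal (x ^ n).toLinearMap i ≤ K ^ n := by
  obtain ⟨c, K, hc, hK, h⟩ := exists_pow_mul_norm_le x
  refine ⟨c, K, hc, hK, fun i hi hi' n => ⟨?_, ?_⟩⟩
  · exact le_sVal (F := ⊤) hi (by positivity) (by simpa using hi') fun v _ => (h n v).1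
  · exact sVal_le (G := ⊤) (by positivity) (by rw [finrank_top]; omega) fun v _ => (h n v).2

theorem sVal_pow_pos (x : H ≃ₗ[ℝ] H) {i : ℕ} (hi : 1 ≤ i) (hi' : i ≤ finrank ℝ H) (n : ℕ) :
    0 < sVal (x ^ n).toLinearMap i := by
  obtain ⟨c, K, hc, -, h⟩ := exists_pow_le_sVal_pow x
  exact (pow_pos hc n).trans_le (h i hi hi' n).1

theorem exists_abs_log_sVal_div_le (x : H ≃ₗ[ℝ] H) {i : ℕ} (hi : 1 ≤ i)
    (hi' : i ≤ finrank ℝ H) : ∃ a b : ℝ, ∀ᶠ n : ℕ in atTop,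
      a ≤ Real.log (sVal (x ^ n).toLinearMap i) / n ∧
        Real.log (sVal (x ^ n).toLinearMap i) / n ≤ b := by
  obtain ⟨c, K, hc, hK, h⟩ := exists_pow_le_sVal_pow x
  refine ⟨Real.log c, Real.log K, ?_⟩
  filter_upwards [eventually_gt_atTop 0] with n hn
  have hn' : (0 : ℝ) < n := by exact_mod_cast hn
  rw [le_div_iff₀ hn', div_le_iff₀ hn', mul_comm, ← Real.log_pow, mul_comm, ← Real.log_pow]
  exact ⟨Real.log_le_log (by positivity) (h i hi hi' n).1,
    Real.log_le_log (sVal_pow_pos x hi hi' n) (h i hi hi' n).2⟩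

theorem eventually_log_sVal_le_of_lyap_lt (x : H ≃ₗ[ℝ] H) {i : ℕ} (hi : 1 ≤ i)
    (hi' : i ≤ finrank ℝ H) {s : ℝ} (hs : lyap x i < s) :
    ∀ᶠ n : ℕ in atTop, Real.log (sVal (x ^ n).toLinearMap i) ≤ s * n := by
  obtain ⟨a, b, h⟩ := exists_abs_log_sVal_div_le x hi hi'
  have hb : IsBoundedUnder (· ≤ ·) atTop
      fun n : ℕ => Real.log (sVal (x ^ n).toLinearMap i) / n :=
    isBoundedUnder_of_eventually_le (h.mono fun _ hn => hn.2)
  filter_upwards [eventually_lt_of_limsup_lt hs hb, eventually_gt_atTop 0] with n hn hn0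
  have hn' : (0 : ℝ) < n := by exact_mod_cast hn0
  exact ((div_lt_iff₀ hn').1 hn).le

theorem lyap_le_of_eventually (x : H ≃ₗ[ℝ] H) {i : ℕ} (hi : 1 ≤ i)
    (hi' : i ≤ finrank ℝ H) {s : ℝ}
    (hs : ∀ᶠ n : ℕ in atTop, Real.log (sVal (x ^ n).toLinearMap i) ≤ s * n) : lyap x i ≤ s := by
  obtain ⟨a, b, h⟩ := exists_abs_log_sVal_div_le x hi hi'
  have ha : IsBoundedUnder (· ≥ ·) atTop
      fun n : ℕ => Real.log (sVal (x ^ n).toLinearMap i) / n :=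
    isBoundedUnder_of_eventually_ge (h.mono fun _ hn => hn.1)
  refine limsup_le_of_le ha.isCoboundedUnder_le ?_
  filter_upwards [hs, eventually_gt_atTop 0] with n hn hn0
  have hn' : (0 : ℝ) < n := by exact_mod_cast hn0
  exact (div_le_iff₀ hn').2 hn

theorem eventually_add_mul_le {a s t : ℝ} (h : s < t) :
    ∀ᶠ n : ℕ in atTop, a + s * n ≤ t * n := by
  have := (tendsto_natCast_atTop_atTop (R := ℝ)).eventually_ge_atTop (a / (t - s))
  filter_upwards [this] with n hn
  rw [div_le_iff₀ (sub_pos.2 h)] at hn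
  linarith

/-- Growth at rate at most `exp s` on a subspace of small codimension bounds `σ_i`. -/
theorem eventually_log_sVal_le_of_growth (x : H ≃ₗ[ℝ] H) {i : ℕ} (hi : 1 ≤ i)
    (hi' : i ≤ finrank ℝ H) {s t : ℝ} (hst : s < t) {N : Submodule ℝ H}
    (hN : finrank ℝ H < finrank ℝ N + i) {K : ℝ} (hK : 0 < K)
    (h : ∀ n : ℕ, ∀ v ∈ N, ‖(x ^ n) v‖ ≤ K * Real.exp s ^ n * ‖v‖) :
    ∀ᶠ n : ℕ in atTop, Real.log (sVal (x ^ n).toLinearMap i) ≤ t * n := by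
  filter_upwards [eventually_add_mul_le (a := Real.log K) hst] with n hn
  refine le_trans ?_ hn
  have h1 : sVal (x ^ n).toLinearMap i ≤ K * Real.exp s ^ n :=
    sVal_le (by positivity) hN fun v hv => h n v hv
  refine (Real.log_le_log (sVal_pow_pos x hi hi' n) h1).trans_eq ?_
  rw [Real.log_mul hK.ne' (by positivity), Real.log_pow, Real.log_exp, mul_comm s]

/-- If `s < θ_i(x)` then the part of the spectral splitting at modulus `exp s` expanding at rate
at least `exp s` has dimension at least `i`. -/
theorem le_finrank_of_lt_lyap (x : H ≃ₗ[ℝ] H) {i : ℕ} (hi : 1 ≤ i) (hi' : i ≤ finrank ℝ H)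
    {s : ℝ} (hs : s < lyap x i) {E N : Submodule ℝ H}
    (hEN : finrank ℝ E + finrank ℝ N = finrank ℝ H)
    (hN : ∀ ρ', Real.exp s < ρ' →
      ∃ K, 0 < K ∧ ∀ n : ℕ, ∀ v ∈ N, ‖(x ^ n) v‖ ≤ K * ρ' ^ n * ‖v‖) : i ≤ finrank ℝ E := by
  by_contra! hlt
  obtain ⟨t, hst, ht⟩ := exists_between hs
  obtain ⟨s', hs', hs't⟩ := exists_between hst
  obtain ⟨K, hK, h⟩ := hN (Real.exp s') (Real.exp_lt_exp.2 hs')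
  exact absurd (lyap_le_of_eventually x hi hi'
    (eventually_log_sVal_le_of_growth x hi hi' hs't (by omega) hK h)) (not_le.2 ht)

theorem eventually_le_log_sVal_of_lt_lyap (x : H ≃ₗ[ℝ] H) {i : ℕ} (hi : 1 ≤ i)
    (hi' : i ≤ finrank ℝ H) {s : ℝ} (hs : s < lyap x i) :
    ∀ᶠ n : ℕ in atTop, s * n ≤ Real.log (sVal (x ^ n).toLinearMap i) := by
  obtain ⟨t, hst, ht⟩ := exists_between hs
  obtain ⟨E, N, hEN, hinv, ⟨K, hK, hE⟩, hN⟩ := exists_spectral_splitting x (Real.exp_pos t)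
  have hiE := le_finrank_of_lt_lyap x hi hi' ht hEN hN
  filter_upwards [eventually_add_mul_le (a := Real.log K) hst] with n hn
  have h1 : K⁻¹ * Real.exp t ^ n ≤ sVal (x ^ n).toLinearMap i :=
    le_sVal hi (by positivity) hiE fun v hv =>
      norm_le_of_inv_pow_contracts hinv hK (Real.exp_pos t) hE n hv
  have h2 := Real.log_le_log (by positivity) h1
  rw [Real.log_mul (by positivity) (by positivity), Real.log_pow, Real.log_exp, Real.log_inv] at h2
  linarith

end SingularValues

section Symplectic

variable {H : Type*} [NormedAddCommGroup H] [InnerProductSpace ℝ H]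
  {ω : H →ₗ[ℝ] H →ₗ[ℝ] ℝ} {Ω : H ≃ₗᵢ[ℝ] H}

theorem form_inv_pow_apply {x : H ≃ₗ[ℝ] H} (hx : ∀ u v : H, ω (x u) (x v) = ω u v) (n : ℕ)
    (u v : H) : ω ((x⁻¹ ^ n) u) ((x⁻¹ ^ n) v) = ω u v := by
  induction n generalizing u v with
  | zero => simp
  | succ n ih =>
    rw [pow_succ, LinearEquiv.mul_apply, LinearEquiv.mul_apply, ih, ← hx,
      ← LinearEquiv.mul_apply, ← LinearEquiv.mul_apply, mul_inv_cancel]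
    rfl

/-- A vector contracted exponentially in the past is `ω`-orthogonal to every vector with bounded
past. -/
theorem form_eq_zero_of_inv_pow_contracts (hΩ : ∀ u v : H, ω u v = ⟪u, Ω v⟫) {x : H ≃ₗ[ℝ] H}
    (hx : ∀ u v : H, ω (x u) (x v) = ω u v) {ρ A B : ℝ} (hρ : 1 < ρ) {u w : H}
    (hu : ∀ n : ℕ, ‖(x⁻¹ ^ n) u‖ ≤ A * ρ⁻¹ ^ n) (hw : ∀ n : ℕ, ‖(x⁻¹ ^ n) w‖ ≤ B) :
    ω u w = 0 := by
  have hB : 0 ≤ B := (norm_nonneg _).trans (hw 0)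
  have hle : ∀ n : ℕ, |ω u w| ≤ A * ρ⁻¹ ^ n * B := fun n => by
    rw [← form_inv_pow_apply hx n, hΩ]
    refine (abs_real_inner_le_norm _ _).trans ?_
    rw [Ω.norm_map]
    exact mul_le_mul (hu n) (hw n) (norm_nonneg _) ((norm_nonneg _).trans (hu n))
  have hlim : Tendsto (fun n : ℕ => A * ρ⁻¹ ^ n * B) atTop (nhds (A * 0 * B)) :=
    ((tendsto_pow_atTop_nhds_zero_of_lt_one (by positivity)
      (inv_lt_one_of_one_lt₀ hρ)).const_mul A).mul_const B
  have := ge_of_tendsto' hlim hle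
  simpa using this

variable [FiniteDimensional ℝ H]

theorem two_mul_finrank_le_of_isotropic (hΩ : ∀ u v : H, ω u v = ⟪u, Ω v⟫) {E : Submodule ℝ H}
    (hE : ∀ u ∈ E, ∀ v ∈ E, ω u v = 0) : 2 * finrank ℝ E ≤ finrank ℝ H := by
  have h1 : E.map Ω.toLinearEquiv.toLinearMap ≤ Eᗮ := by
    rintro _ ⟨v, hv, rfl⟩
    rw [Submodule.mem_orthogonal]
    exact fun u hu => (hΩ u v).symm.trans (hE u hu v hv)
  have h2 := Submodule.finrank_mono h1
  rw [LinearEquiv.finrank_map_eq Ω.toLinearEquiv E] at h2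
  have h3 := E.finrank_add_finrank_orthogonal
  omega

/-- A subspace on which the past of a symplectic map with a nonzero fixed vector contracts has
less than half the dimension. -/
theorem two_mul_finrank_add_two_le (halt : ∀ u v : H, ω u v = - ω v u)
    (hΩ : ∀ u v : H, ω u v = ⟪u, Ω v⟫) {x : H ≃ₗ[ℝ] H}
    (hx : ∀ u v : H, ω (x u) (x v) = ω u v) {v : H} (hv0 : v ≠ 0) (hv : x v = v)
    {E : Submodule ℝ H} {ρ K : ℝ} (hρ : 1 < ρ) (hK : 0 < K)
    (hE : ∀ n : ℕ, ∀ u ∈ E, ‖(x⁻¹ ^ n) u‖ ≤ K * ρ⁻¹ ^ n * ‖u‖) :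
    2 * finrank ℝ E + 2 ≤ finrank ℝ H := by
  have hinv : x⁻¹ v = v := by
    conv_lhs => rw [← hv]
    rw [← LinearEquiv.mul_apply, inv_mul_cancel]
    rfl
  have hvn : ∀ n : ℕ, (x⁻¹ ^ n) v = v := fun n => by
    rw [LinearEquiv.pow_apply]
    exact Function.iterate_fixed hinv n
  have hcontr : ∀ u ∈ E, ∀ n : ℕ, ‖(x⁻¹ ^ n) u‖ ≤ K * ‖u‖ * ρ⁻¹ ^ n := fun u hu n =>
    (hE n u hu).trans_eq (by ring)
  have hρ1 : ∀ n : ℕ, ρ⁻¹ ^ n ≤ 1 := fun n =>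
    pow_le_one₀ (by positivity) (inv_le_one_of_one_le₀ hρ.le)
  have hEE : ∀ u ∈ E, ∀ w ∈ E, ω u w = 0 := fun u hu w hw =>
    form_eq_zero_of_inv_pow_contracts hΩ hx hρ (hcontr u hu) (B := K * ‖w‖) fun n =>
      (hcontr w hw n).trans (mul_le_of_le_one_right (by positivity) (hρ1 n))
  have hEv : ∀ u ∈ E, ω u v = 0 := fun u hu =>
    form_eq_zero_of_inv_pow_contracts hΩ hx hρ (hcontr u hu) (B := ‖v‖) fun n => by rw [hvn]
  have hvE : v ∉ E := fun hmem => by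
    have hlim : Tendsto (fun n : ℕ => K * ‖v‖ * ρ⁻¹ ^ n) atTop (nhds (K * ‖v‖ * 0)) :=
      (tendsto_pow_atTop_nhds_zero_of_lt_one (by positivity)
        (inv_lt_one_of_one_lt₀ hρ)).const_mul _
    have := ge_of_tendsto' hlim fun n => by
      have := hcontr v hmem n
      rwa [hvn] at this
    exact hv0 (by simpa using this)
  have hvv : ω v v = 0 := by linarith [halt v v]
  have hiso : ∀ a ∈ E ⊔ Submodule.span ℝ {v}, ∀ b ∈ E ⊔ Submodule.span ℝ {v}, ω a b = 0 := by
    intro a ha b hb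
    obtain ⟨u, hu, y, hy, rfl⟩ := Submodule.mem_sup.1 ha
    obtain ⟨u', hu', y', hy', rfl⟩ := Submodule.mem_sup.1 hb
    obtain ⟨c, rfl⟩ := Submodule.mem_span_singleton.1 hy
    obtain ⟨c', rfl⟩ := Submodule.mem_span_singleton.1 hy'
    simp [hEE u hu u' hu', hEv u hu, halt v u', hEv u' hu', hvv]
  have h1 := two_mul_finrank_le_of_isotropic hΩ hiso
  have h2 := Submodule.finrank_sup_add_finrank_inf_eq E (Submodule.span ℝ {v})
  rw [finrank_span_singleton hv0, ((Submodule.disjoint_span_singleton' hv0).2 hvE).eq_bot,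
    finrank_bot] at h2
  omega

/-- A fixed vector spanning the fixed space of a symplectic map is in the range of `x - 1`. -/
theorem exists_apply_eq_add (halt : ∀ u v : H, ω u v = - ω v u)
    (hnd : ∀ u : H, (∀ v : H, ω u v = 0) → u = 0)
    (hΩ : ∀ u v : H, ω u v = ⟪u, Ω v⟫) {x : H ≃ₗ[ℝ] H}
    (hx : ∀ u v : H, ω (x u) (x v) = ω u v) {v : H}
    (hfix : ∀ z : H, x z = z → ∃ c : ℝ, c • v = z) : ∃ w : H, x w = w + v := by
  let R : Submodule ℝ H := LinearMap.range (x.toLinearMap - LinearMap.id)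
  suffices h : v ∈ R by
    obtain ⟨w, hw⟩ := h
    refine ⟨w, ?_⟩
    rw [← hw]
    simp
  rw [← R.orthogonal_orthogonal, Submodule.mem_orthogonal']
  intro y hy
  obtain ⟨z, rfl⟩ := Ω.surjective y
  have hz : x z = z := by
    rw [Submodule.mem_orthogonal] at hy
    have : z - x z = 0 := hnd _ fun a => by
      obtain ⟨h, rfl⟩ := x.surjective a
      have h1 : ω (x h - h) z = 0 := by
        rw [hΩ]
        exact hy _ ⟨h, rfl⟩
      rw [map_sub, LinearMap.sub_apply, ← hx h z] at h1
      rw [halt, map_sub]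
      linarith
    exact (sub_eq_zero.1 this).symm
  obtain ⟨c, rfl⟩ := hfix z hz
  rw [← hΩ, map_smul]
  have hvv : ω v v = 0 := by linarith [halt v v]
  simp [hvv]

theorem exists_mul_add_norm_le_norm_add {A B : Submodule ℝ H} (hAB : Disjoint A B) :
    ∃ c, 0 < c ∧ ∀ a ∈ A, ∀ b ∈ B, c * (‖a‖ + ‖b‖) ≤ ‖a + b‖ := by
  have hker : LinearMap.ker (A.subtype.coprod B.subtype) = ⊥ := by
    rw [LinearMap.ker_coprod_of_disjoint_range]
    · simp
    · simpa using hAB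
  obtain ⟨L, hL, h⟩ := (A.subtype.coprod B.subtype).exists_antilipschitzWith hker
  have hL' : (0 : ℝ) < L := hL
  refine ⟨(2 * L : ℝ)⁻¹, by positivity, fun a ha b hb => ?_⟩
  have h1 := h.le_mul_dist (⟨a, ha⟩, ⟨b, hb⟩) 0
  rw [dist_zero_right, map_zero, dist_zero_right] at h1
  have h2 : ‖a‖ ≤ L * ‖a + b‖ := (norm_fst_le _).trans h1
  have h3 : ‖b‖ ≤ L * ‖a + b‖ := (norm_snd_le _).trans h1
  rw [inv_mul_le_iff₀ (by positivity)]
  linarith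

/-- If `E` is expanded exponentially and `v`, `w` span a Jordan block for the eigenvalue `1`, then
`σ_i(xⁿ) → ∞` for all `i ≤ dim E + 1`. -/
theorem tendsto_sVal_pow_atTop {x : H ≃ₗ[ℝ] H} {E : Submodule ℝ H} {ρ k : ℝ}
    (hinv : ∀ u ∈ E, ∀ n : ℕ, (x ^ n) u ∈ E) (hρ : 1 < ρ) (hk : 0 < k)
    (hE : ∀ n : ℕ, ∀ u ∈ E, k * ρ ^ n * ‖u‖ ≤ ‖(x ^ n) u‖) {v w : H} (hv0 : v ≠ 0)
    (hv : x v = v) (hw : x w = w + v) {i : ℕ} (hi : 1 ≤ i) (hiE : i ≤ finrank ℝ E + 1) :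
    Tendsto (fun n : ℕ => sVal (x ^ n).toLinearMap i) atTop atTop := by
  have hvn : ∀ n : ℕ, (x ^ n) v = v := fun n => by
    rw [LinearEquiv.pow_apply]
    exact Function.iterate_fixed hv n
  have hwn : ∀ n : ℕ, (x ^ n) w = w + (n : ℝ) • v := fun n => by
    induction n with
    | zero => simp
    | succ n ih =>
      rw [pow_succ, LinearEquiv.mul_apply, hw, map_add, ih, hvn]
      push_cast
      rw [add_smul, one_smul, add_assoc]
  have hw0 : w ≠ 0 := by
    rintro rfl
    rw [map_zero, zero_add] at hw
    exact hv0 hw.symm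
  have hdisj : Disjoint E (Submodule.span ℝ {w, v}) := by
    rw [Submodule.disjoint_def]
    intro z hzE hz
    obtain ⟨a, b, rfl⟩ := Submodule.mem_span_pair.1 hz
    set z := a • w + b • v with hzdef
    have hzn : ∀ n : ℕ, ‖(x ^ n) z‖ ≤ ‖z‖ + n * ‖a • v‖ := fun n => by
      have : (x ^ n) z = z + (n : ℝ) • a • v := by
        rw [hzdef, map_add, map_smul, map_smul, hwn, hvn, smul_add, smul_comm a (n : ℝ) v]
        abel
      rw [this]
      refine (norm_add_le _ _).trans ?_
      rw [norm_smul (n : ℝ), Real.norm_natCast]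
    have hle : ∀ n : ℕ, k * ‖z‖ ≤ ‖z‖ * ρ⁻¹ ^ n + ‖a • v‖ * (n * ρ⁻¹ ^ n) := fun n => by
      have h1 := (hE n z hzE).trans (hzn n)
      have hρn : 0 < ρ ^ n := by positivity
      rw [inv_pow]
      calc k * ‖z‖ = k * ρ ^ n * ‖z‖ * (ρ ^ n)⁻¹ := by field_simp
        _ ≤ (‖z‖ + n * ‖a • v‖) * (ρ ^ n)⁻¹ := by gcongr
        _ = _ := by ring
    have hρ' := inv_lt_one_of_one_lt₀ hρ
    have hlim : Tendsto (fun n : ℕ => ‖z‖ * ρ⁻¹ ^ n + ‖a • v‖ * (n * ρ⁻¹ ^ n)) atTop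
        (nhds (‖z‖ * 0 + ‖a • v‖ * 0)) :=
      ((tendsto_pow_atTop_nhds_zero_of_lt_one (by positivity) hρ').const_mul _).add
        ((tendsto_self_mul_const_pow_of_lt_one (by positivity) hρ').const_mul _)
    have h0 := ge_of_tendsto' hlim hle
    rw [mul_zero, mul_zero, add_zero] at h0
    exact norm_le_zero_iff.1 (nonpos_of_mul_nonpos_right h0 hk)
  obtain ⟨c, hc, hsum⟩ := exists_mul_add_norm_le_norm_add hdisj
  have hwmem : w ∈ Submodule.span ℝ {w, v} := Submodule.subset_span (by simp)
  have hvmem : v ∈ Submodule.span ℝ {w, v} := Submodule.subset_span (by simp)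
  have hdim : i ≤ finrank ℝ (E ⊔ Submodule.span ℝ {w} : Submodule ℝ H) := by
    have h2 := Submodule.finrank_sup_add_finrank_inf_eq E (Submodule.span ℝ {w})
    rw [finrank_span_singleton hw0, (hdisj.mono_right
      (Submodule.span_mono (by simp))).eq_bot, finrank_bot] at h2
    omega
  have hv0' : 0 < ‖v‖ := norm_pos_iff.2 hv0
  rw [tendsto_atTop]
  intro L
  have h1 : Tendsto (fun n : ℕ => c * (k * ρ ^ n)) atTop atTop :=
    ((tendsto_pow_atTop_atTop_of_one_lt hρ).const_mul_atTop hk).const_mul_atTop hc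
  have h2 : Tendsto (fun n : ℕ => c * (n * ‖v‖ - ‖w‖)) atTop atTop :=
    (tendsto_atTop_add_const_right _ _
      (tendsto_natCast_atTop_atTop.atTop_mul_const hv0')).const_mul_atTop hc
  filter_upwards [h1.eventually_ge_atTop (max L 0),
    h2.eventually_ge_atTop (max L 0 * ‖w‖)] with n hn1 hn2
  refine (le_max_left L 0).trans (le_sVal hi (le_max_right L 0) hdim fun f hf => ?_)
  obtain ⟨u, hu, y, hy, rfl⟩ := Submodule.mem_sup.1 hf
  obtain ⟨b, rfl⟩ := Submodule.mem_span_singleton.1 hy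
  have hmem : b • (w + (n : ℝ) • v) ∈ Submodule.span ℝ {w, v} :=
    Submodule.smul_mem _ _ (Submodule.add_mem _ hwmem (Submodule.smul_mem _ _ hvmem))
  have hlow : n * ‖v‖ - ‖w‖ ≤ ‖w + (n : ℝ) • v‖ := by
    have := norm_sub_le (w + (n : ℝ) • v) w
    rw [add_sub_cancel_left, norm_smul, Real.norm_natCast] at this
    linarith
  calc max L 0 * ‖u + b • w‖ ≤ max L 0 * (‖u‖ + |b| * ‖w‖) := by
        gcongr
        refine (norm_add_le _ _).trans_eq ?_
        rw [norm_smul, Real.norm_eq_abs]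
    _ = max L 0 * ‖u‖ + |b| * (max L 0 * ‖w‖) := by ring
    _ ≤ c * (k * ρ ^ n) * ‖u‖ + |b| * (c * (n * ‖v‖ - ‖w‖)) := by gcongr
    _ = c * (k * ρ ^ n * ‖u‖ + |b| * (n * ‖v‖ - ‖w‖)) := by ring
    _ ≤ c * (‖(x ^ n) u‖ + |b| * ‖w + (n : ℝ) • v‖) := by
        gcongr
        exact hE n u hu
    _ = c * (‖(x ^ n) u‖ + ‖b • (w + (n : ℝ) • v)‖) := by
        rw [norm_smul, Real.norm_eq_abs]
    _ ≤ ‖(x ^ n) u + b • (w + (n : ℝ) • v)‖ := hsum _ (hinv u hu n) _ hmem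
    _ = ‖(x ^ n).toLinearMap (u + b • w)‖ := by
        rw [LinearEquiv.coe_coe, map_add, map_smul, hwn]

end Symplectic

theorem lyap_zero {H : Type*} [NormedAddCommGroup H] [InnerProductSpace ℝ H] (x : H ≃ₗ[ℝ] H) :
    lyap x 0 = 0 := by
  have h : ∀ y : H →ₗ[ℝ] H, sVal y 0 = 0 := fun y => by
    refine Real.sSup_of_not_bddAbove fun ⟨B, hB⟩ => ?_
    have := hB (show |B| + 1 ∈ _ from ⟨by positivity, ⊥, finrank_bot ℝ H, by simp⟩)
    linarith [le_abs_self B]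
  simp [lyap, h]

/-- If for every `C > 0` there is an element of the symplectically acting monoid `ℬ`
having `1` as an eigenvalue of geometric multiplicity `1` and whose Lyapunov exponents
satisfy `θ_{g−1} > 0` and `θ_k > C θ_{k+1}` for `1 ≤ k ≤ g − 2`, then `ℬ` is strongly
pinching. -/
theorem stmt15 {H : Type*} [NormedAddCommGroup H] [InnerProductSpace ℝ H]
    [FiniteDimensional ℝ H] (g : ℕ)
    (hdim : finrank ℝ H = 2 * g)
    (ω : H →ₗ[ℝ] H →ₗ[ℝ] ℝ)
    (halt : ∀ u v : H, ω u v = - ω v u)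
    (hnd : ∀ u : H, (∀ v : H, ω u v = 0) → u = 0)
    -- the inner product is adapted to `ω`
    (Ω : H ≃ₗᵢ[ℝ] H) (hΩ : ∀ u v : H, ω u v = ⟪u, Ω v⟫)
    (M : Submonoid (H ≃ₗ[ℝ] H))
    (hM : ∀ x ∈ M, ∀ u v : H, ω (x u) (x v) = ω u v)
    (hyp : ∀ C : ℝ, 0 < C → ∃ x ∈ M,
      finrank ℝ (Module.End.eigenspace (x.toLinearMap : Module.End ℝ H) 1) = 1 ∧
      0 < lyap x (g - 1) ∧
      ∀ k : ℕ, 1 ≤ k → k ≤ g - 2 → C * lyap x (k + 1) < lyap x k) :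
    ∀ C : ℝ, 0 < C → ∃ y ∈ M,
      C < Real.log (sVal y.toLinearMap g) ∧
      ∀ i : ℕ, 1 ≤ i → i ≤ g - 1 →
        C * Real.log (sVal y.toLinearMap (i + 1)) < Real.log (sVal y.toLinearMap i) := by
  intro C hC
  obtain ⟨x, hxM, heig, hpos, hgap⟩ := hyp C hC
  have hx := hM x hxM
  obtain ⟨v', hv'0, hv'⟩ := finrank_eq_one_iff'.1 heig
  obtain ⟨v, hvmem⟩ := v'
  have hv0 : v ≠ 0 := fun h => hv'0 (Subtype.ext h)
  have hv : x v = v := by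
    simpa using Module.End.mem_eigenspace_iff.1 hvmem
  have hfix : ∀ z : H, x z = z → ∃ c : ℝ, c • v = z := fun z hz => by
    obtain ⟨c, hc⟩ := hv' ⟨z, Module.End.mem_eigenspace_iff.2 (by simpa using hz)⟩
    exact ⟨c, congrArg Subtype.val hc⟩
  obtain ⟨w, hw⟩ := exists_apply_eq_add halt hnd hΩ hx hfix
  have hg : 2 ≤ g := by
    by_contra! h
    rw [show g - 1 = 0 by omega, lyap_zero] at hpos
    exact lt_irrefl _ hpos
  -- `σ_g(xⁿ)` tends to infinity
  have hlarge : Tendsto (fun n : ℕ => sVal (x ^ n).toLinearMap g) atTop atTop := by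
    obtain ⟨t, ht0, ht⟩ := exists_between hpos
    obtain ⟨E, N, hEN, hinv, ⟨K, hK, hE⟩, hN⟩ := exists_spectral_splitting x (Real.exp_pos t)
    have hdimE := le_finrank_of_lt_lyap x (by omega) (by omega) ht hEN hN
    exact tendsto_sVal_pow_atTop hinv (Real.one_lt_exp_iff.2 ht0) (inv_pos.2 hK)
      (fun n u hu => norm_le_of_inv_pow_contracts hinv hK (Real.exp_pos t) hE n hu) hv0 hv hw
      (by omega) (by omega)
  -- `σ_g(xⁿ)` grows subexponentially
  have hsub : ∀ s : ℝ, 0 < s →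
      ∀ᶠ n : ℕ in atTop, Real.log (sVal (x ^ n).toLinearMap g) ≤ s * n := by
    intro s hs
    obtain ⟨t, ht0, hts⟩ := exists_between hs
    obtain ⟨t', htt', ht's⟩ := exists_between hts
    obtain ⟨E, N, hEN, hinv, ⟨K, hK, hE⟩, hN⟩ := exists_spectral_splitting x (Real.exp_pos t)
    have hdimE := two_mul_finrank_add_two_le halt hΩ hx hv0 hv (Real.one_lt_exp_iff.2 ht0) hK hE
    obtain ⟨L, hL, hNL⟩ := hN (Real.exp t') (Real.exp_lt_exp.2 htt')
    exact eventually_log_sVal_le_of_growth x (by omega) (by omega) ht's (by omega) hL hNL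
  have hgaps : ∀ i ∈ Finset.Icc 1 (g - 1), ∀ᶠ n : ℕ in atTop,
      C * Real.log (sVal (x ^ n).toLinearMap (i + 1)) <
        Real.log (sVal (x ^ n).toLinearMap i) := by
    intro i hi
    rw [Finset.mem_Icc] at hi
    obtain ⟨s, t, hst, hs, ht⟩ : ∃ s t : ℝ, C * s < t ∧
        (∀ᶠ n : ℕ in atTop, Real.log (sVal (x ^ n).toLinearMap (i + 1)) ≤ s * n) ∧
        t < lyap x i := by
      rcases eq_or_ne i (g - 1) with rfl | hne
      · obtain ⟨t, ht0, ht⟩ := exists_between hpos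
        obtain ⟨s, hs0, hs⟩ := exists_between (div_pos ht0 hC)
        refine ⟨s, t, ?_, ?_, ht⟩
        · rwa [lt_div_iff₀' hC] at hs
        · rw [show g - 1 + 1 = g by omega]
          exact hsub s hs0
      · obtain ⟨t, ht', ht⟩ := exists_between (hgap i hi.1 (by omega))
        rw [← lt_div_iff₀' hC] at ht'
        obtain ⟨s, hs', hs⟩ := exists_between ht'
        rw [lt_div_iff₀' hC] at hs
        exact ⟨s, t, hs, eventually_log_sVal_le_of_lyap_lt x (by omega) (by omega) hs', ht⟩
    filter_upwards [hs, eventually_le_log_sVal_of_lt_lyap x hi.1 (by omega) ht,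
      eventually_gt_atTop 0] with n h1 h2 hn
    have hn' : (0 : ℝ) < n := by exact_mod_cast hn
    calc C * Real.log (sVal (x ^ n).toLinearMap (i + 1)) ≤ C * (s * n) := by gcongr
      _ = C * s * n := by ring
      _ < t * n := by gcongr
      _ ≤ _ := h2
  obtain ⟨n, hn1, hn2⟩ := (((Real.tendsto_log_atTop.comp hlarge).eventually_gt_atTop C).and
    ((Filter.eventually_all_finset _).2 hgaps)).exists
  exact ⟨x ^ n, pow_mem hxM n, hn1, fun i hi hi' => hn2 i (Finset.mem_Icc.2 ⟨hi, hi'⟩)⟩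
end
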